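/- arXiv:1308.5173 — 6 statements merged into one kernel-verified Lean document; each statement's English description precedes it below -/
import Mathlib

section
/- Let G be a finite, d-regular (d ≥ 3), vertex-transitive simple graph and let λ_min be the least eigenvalue of its adjacency matrix. Then the independence ratio of G is at least 1/2 − (1/3)·√(d·(λ_min + d)). -/
open Matrix

open MeasureTheory ProbabilityTheory Set Real
open scoped RealInnerProductSpace ENNReal NNReal

section Gaussian

theorem integral_Ioi_mul_gaussianPDFReal :
    ∫ x in Ioi (0 : ℝ), x * gaussianPDFReal 0 1 x = (√(2 * π))⁻¹ := by
  have h := integral_rpow_mul_exp_neg_mul_rpow (p := 2) (q := 1) (b := 1 / 2)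
    (by norm_num) (by norm_num) (by norm_num)
  have h1 : ∀ x : ℝ, x * gaussianPDFReal 0 1 x =
      (√(2 * π))⁻¹ * (x ^ (1 : ℝ) * rexp (-(1 / 2) * x ^ (2 : ℝ))) := by
    intro x
    simp only [gaussianPDFReal, NNReal.coe_one, mul_one, sub_zero, rpow_one, rpow_two]
    rw [show -x ^ 2 / 2 = -(1 / 2) * x ^ 2 by ring]
    ring
  simp_rw [h1]
  rw [integral_const_mul, h]
  norm_num [Real.rpow_neg_one]

theorem integrableOn_Ioi_mul_gaussianPDFReal :
    IntegrableOn (fun x : ℝ => x * gaussianPDFReal 0 1 x) (Ioi 0) := by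
  by_contra h
  have := integral_Ioi_mul_gaussianPDFReal
  rw [integral_undef h] at this
  have : 0 < (√(2 * π))⁻¹ := by positivity
  linarith

theorem gaussianPDFReal_zero_one_le (x : ℝ) : gaussianPDFReal 0 1 x ≤ (√(2 * π))⁻¹ := by
  simp only [gaussianPDFReal, NNReal.coe_one, mul_one, sub_zero]
  refine mul_le_of_le_one_right (by positivity) ?_
  rw [Real.exp_le_one_iff]
  nlinarith [sq_nonneg x]

theorem gaussianReal_Ioo_neg_le {t : ℝ} :
    gaussianReal 0 1 (Ioo (-t) t) ≤ ENNReal.ofReal (2 * t * (√(2 * π))⁻¹) := by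
  rw [gaussianReal_apply 0 one_ne_zero]
  calc ∫⁻ x in Ioo (-t) t, gaussianPDF 0 1 x
      ≤ ∫⁻ _ in Ioo (-t) t, ENNReal.ofReal (√(2 * π))⁻¹ :=
        lintegral_mono fun x => ENNReal.ofReal_le_ofReal (gaussianPDFReal_zero_one_le x)
    _ = ENNReal.ofReal (2 * t * (√(2 * π))⁻¹) := by
        rw [setLIntegral_const, Real.volume_Ioo, ← ENNReal.ofReal_mul (by positivity)]
        congr 1
        ring

/-- A pair of independent standard Gaussians lies in the cone `|y| < s * x` with probability
at most `s / π`. -/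
theorem gaussianReal_prod_cone_le {s : ℝ} (hs : 0 ≤ s) :
    ((gaussianReal 0 1).prod (gaussianReal 0 1)) {z : ℝ × ℝ | |z.2| < s * z.1} ≤
      ENNReal.ofReal (s / π) := by
  have hm : MeasurableSet {z : ℝ × ℝ | |z.2| < s * z.1} :=
    measurableSet_lt (by fun_prop) (by fun_prop)
  have hc : (√(2 * π))⁻¹ * (√(2 * π))⁻¹ = (2 * π)⁻¹ := by
    rw [← mul_inv, Real.mul_self_sqrt (by positivity)]
  have hslice : ∀ x : ℝ, Prod.mk x ⁻¹' {z : ℝ × ℝ | |z.2| < s * z.1} =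
      Ioo (-(s * x)) (s * x) := fun x => by
    ext y
    simp [abs_lt]
  rw [Measure.prod_apply hm, gaussianReal_of_var_ne_zero 0 one_ne_zero,
    lintegral_withDensity_eq_lintegral_mul₀ (measurable_gaussianPDF 0 1).aemeasurable
      (measurable_measure_prodMk_left hm).aemeasurable,
    ← gaussianReal_of_var_ne_zero 0 one_ne_zero]
  calc ∫⁻ x, (gaussianPDF 0 1 * fun x => gaussianReal 0 1
          (Prod.mk x ⁻¹' {z : ℝ × ℝ | |z.2| < s * z.1})) x
      ≤ ∫⁻ x, (Ioi (0 : ℝ)).indicator (fun x => ENNReal.ofReal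
          (2 * s * (√(2 * π))⁻¹ * (x * gaussianPDFReal 0 1 x))) x := by
        refine lintegral_mono fun x => ?_
        simp only [Pi.mul_apply, hslice]
        by_cases hx : 0 < x
        · rw [indicator_of_mem (mem_Ioi.2 hx)]
          refine (mul_le_mul_right gaussianReal_Ioo_neg_le _).trans_eq ?_
          rw [gaussianPDF, ← ENNReal.ofReal_mul (gaussianPDFReal_nonneg _ _ _)]
          congr 1
          ring
        · have : s * x ≤ 0 := mul_nonpos_of_nonneg_of_nonpos hs (not_lt.1 hx)
          rw [Ioo_eq_empty (by linarith)]
          simp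
    _ = ENNReal.ofReal (s / π) := by
        rw [lintegral_indicator measurableSet_Ioi, ← ofReal_integral_eq_lintegral_ofReal
          (integrableOn_Ioi_mul_gaussianPDFReal.const_mul _), integral_const_mul,
          integral_Ioi_mul_gaussianPDFReal, mul_assoc, hc]
        · congr 1
          field_simp
        · filter_upwards [self_mem_ae_restrict measurableSet_Ioi] with x hx
          have := gaussianPDFReal_nonneg 0 1 x
          have : 0 < x := hx
          positivity

theorem gaussianReal_Ioi_zero {v : ℝ≥0} (hv : v ≠ 0) : (gaussianReal 0 v).real (Ioi 0) = 1 / 2 := by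
  have hneg : (gaussianReal 0 v).real (Iio 0) = (gaussianReal 0 v).real (Ioi 0) := by
    have h := gaussianReal_map_neg (μ := 0) (v := v)
    rw [neg_zero] at h
    conv_lhs => rw [← h]
    rw [map_measureReal_apply measurable_neg measurableSet_Iio]
    congr 1
    ext x
    simp
  have := nullSingletonClass_gaussianReal (μ := 0) hv
  have hc := probReal_add_probReal_compl (μ := gaussianReal 0 v) (measurableSet_Ioi (a := (0 : ℝ)))
  rw [compl_Ioi, ← measureReal_congr Iio_ae_eq_Iic, hneg] at hc
  linarith

variable {E : Type*} [NormedAddCommGroup E] [InnerProductSpace ℝ E] [FiniteDimensional ℝ E]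
  [MeasurableSpace E] [BorelSpace E]

theorem stdGaussian_map_inner (a : E) :
    (stdGaussian E).map (fun g => ⟪a, g⟫) = gaussianReal 0 (‖a‖₊ ^ 2) := by
  have h := IsGaussian.map_eq_gaussianReal (μ := stdGaussian E) (innerSL ℝ a)
  rw [variance_dual_stdGaussian, integral_strongDual_stdGaussian, innerSL_apply_norm,
    Real.toNNReal_pow (norm_nonneg a), norm_toNNReal] at h
  exact h

theorem stdGaussian_map_inner_prod {a b : E} (ha : ‖a‖ = 1) (hb : ‖b‖ = 1) (hab : ⟪a, b⟫ = 0) :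
    (stdGaussian E).map (fun g => (⟪a, g⟫, ⟪b, g⟫)) =
      (gaussianReal 0 1).prod (gaussianReal 0 1) := by
  have hind : IndepFun (fun g => ⟪a, g⟫) (fun g => ⟪b, g⟫) (stdGaussian E) := by
    refine HasGaussianLaw.indepFun_of_covariance_eq_zero ?_ ?_
    · exact (IsGaussian.hasGaussianLaw_id (μ := stdGaussian E)).map_fun
        ((innerSL ℝ a).prod (innerSL ℝ b))
    · rw [← covarianceBilin_apply_eq_cov IsGaussian.memLp_two_id, covarianceBilin_stdGaussian]
      exact hab
  rw [(indepFun_iff_map_prod_eq_prod_map_map (by fun_prop) (by fun_prop)).1 hind,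
    stdGaussian_map_inner, stdGaussian_map_inner]
  have ha' : ‖a‖₊ = 1 := NNReal.eq ha
  have hb' : ‖b‖₊ = 1 := NNReal.eq hb
  simp [ha', hb']

theorem stdGaussian_inner_pos {a : E} (ha : a ≠ 0) :
    (stdGaussian E).real {g | 0 < ⟪a, g⟫} = 1 / 2 := by
  rw [← gaussianReal_Ioi_zero (v := ‖a‖₊ ^ 2) (by simpa using ha), ← stdGaussian_map_inner,
    map_measureReal_apply (by fun_prop) measurableSet_Ioi]
  rfl

theorem stdGaussian_cone_le {a b : E} (hb : b ≠ 0) (hab : ⟪a, b⟫ = 0) :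
    (stdGaussian E).real {g | |⟪b, g⟫| < ⟪a, g⟫} ≤ ‖a‖ / ‖b‖ / π := by
  rcases eq_or_ne a 0 with rfl | ha
  · have (g : E) : ¬ |⟪b, g⟫| < 0 := (abs_nonneg _).not_gt
    simp [this]
  have hna : 0 < ‖a‖ := norm_pos_iff.2 ha
  have hnb : 0 < ‖b‖ := norm_pos_iff.2 hb
  refine ENNReal.toReal_le_of_le_ofReal (by positivity) ?_
  refine le_trans (le_of_eq ?_) (gaussianReal_prod_cone_le (s := ‖a‖ / ‖b‖) (by positivity))
  rw [← stdGaussian_map_inner_prod (a := ‖a‖⁻¹ • a) (b := ‖b‖⁻¹ • b) (norm_smul_inv_norm ha)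
    (norm_smul_inv_norm hb) (by simp [inner_smul_left, inner_smul_right, hab]),
    Measure.map_apply (by fun_prop) (measurableSet_lt (by fun_prop) (by fun_prop))]
  congr 1
  ext g
  simp only [mem_ofPred_eq, mem_preimage, inner_smul_left, conj_trivial, abs_mul, abs_inv, abs_norm]
  rw [show ‖a‖ / ‖b‖ * (‖a‖⁻¹ * ⟪a, g⟫) = ‖b‖⁻¹ * ⟪a, g⟫ by field_simp]
  exact (mul_lt_mul_iff_right₀ (by positivity)).symm

/-- Two nearly opposite standard Gaussian variables are rarely both positive. -/
theorem stdGaussian_inner_pos_inner_pos_le {p q : E} (hp : ‖p‖ = 1) (hq : ‖q‖ = 1)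
    (hpq : ⟪p, q⟫ ≤ 0) :
    (stdGaussian E).real {g | 0 < ⟪p, g⟫ ∧ 0 < ⟪q, g⟫} ≤ √(1 + ⟪p, q⟫) / 3 := by
  have hadd : ‖p + q‖ ^ 2 = 2 * (1 + ⟪p, q⟫) := by
    rw [norm_add_sq_real, hp, hq]
    ring
  have hsub : ‖p - q‖ ^ 2 = 2 * (1 - ⟪p, q⟫) := by
    rw [norm_sub_sq_real, hp, hq]
    ring
  have hnorm : 0 < ‖p - q‖ ∧ ‖p + q‖ ≤ √(1 + ⟪p, q⟫) * ‖p - q‖ := by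
    have hδ : 0 ≤ 1 + ⟪p, q⟫ := by nlinarith [sq_nonneg ‖p + q‖]
    refine ⟨(norm_nonneg _).lt_of_ne fun h => ?_, ?_⟩
    · rw [← h] at hsub
      linarith
    · refine abs_le_of_sq_le_sq' ?_ (by positivity) |>.2
      rw [mul_pow, Real.sq_sqrt hδ, hadd, hsub]
      nlinarith
  obtain ⟨hpos, hle⟩ := hnorm
  have horth : ⟪p + q, p - q⟫ = 0 := by
    rw [real_inner_add_sub_eq_zero_iff, hp, hq]
  have hset : {g : E | 0 < ⟪p, g⟫ ∧ 0 < ⟪q, g⟫} = {g | |⟪p - q, g⟫| < ⟪p + q, g⟫} := by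
    ext g
    simp only [mem_ofPred_eq, inner_sub_left, inner_add_left, abs_lt]
    constructor
    · rintro ⟨h1, h2⟩
      constructor <;> linarith
    · rintro ⟨h1, h2⟩
      constructor <;> linarith
  rw [hset]
  refine (stdGaussian_cone_le (norm_pos_iff.1 hpos) horth).trans ?_
  exact div_le_div₀ (by positivity) ((div_le_iff₀ hpos).2 hle) (by norm_num) pi_gt_three.le

end Gaussian

section Graph

variable {V : Type*} [Fintype V] (G : SimpleGraph V) [DecidableRel G.Adj]

/-- A vertex-transitive graph has, for each eigenvalue `lam`, an assignment of unit vectors to its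
vertices satisfying the eigenvector equation for `lam`. -/
theorem exists_unit_vectors_sum_neighbors_eq (htrans : ∀ u v : V, ∃ φ : G ≃g G, φ u = v)
    {lam : ℝ} {x : V → ℝ} (hx : x ≠ 0) (hlam : G.adjMatrix ℝ *ᵥ x = lam • x) :
    ∃ (n : ℕ) (p : V → EuclideanSpace ℝ (Fin n)), (∀ v, ‖p v‖ = 1) ∧
      ∀ v, ∑ u ∈ G.neighborFinset v, p u = lam • p v := by
  classical
  have : Finite (G ≃g G) := DFunLike.finite _
  have := Fintype.ofFinite (G ≃g G)
  let e := Fintype.equivFin (G ≃g G)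
  let q : V → EuclideanSpace ℝ (Fin (Fintype.card (G ≃g G))) :=
    fun v => WithLp.toLp 2 fun i => x (e.symm i v)
  have hq : ∀ v i, q v i = x (e.symm i v) := fun v i => rfl
  have hsq : ∀ v, ‖q v‖ ^ 2 = ∑ φ : G ≃g G, x (φ v) ^ 2 := fun v => by
    rw [EuclideanSpace.real_norm_sq_eq]
    exact Equiv.sum_comp e.symm fun φ : G ≃g G => x (φ v) ^ 2
  have hconst : ∀ u v, ‖q u‖ = ‖q v‖ := fun u v => by
    obtain ⟨ψ, rfl⟩ := htrans u v
    rw [← sq_eq_sq₀ (norm_nonneg _) (norm_nonneg _), hsq, hsq]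
    exact (Equiv.sum_comp (Equiv.mulRight ψ) fun φ : G ≃g G => x (φ u) ^ 2).symm
  have heig : ∀ v, ∑ u ∈ G.neighborFinset v, q u = lam • q v := fun v => by
    ext i
    have h := congrFun hlam (e.symm i v)
    rw [SimpleGraph.adjMatrix_mulVec_apply] at h
    simp only [WithLp.ofLp_sum, Finset.sum_apply, PiLp.smul_apply, hq]
    rw [← Pi.smul_apply, ← h]
    refine Finset.sum_bij (fun u _ => e.symm i u) ?_ ?_ ?_ ?_
    · intro u hu
      rw [SimpleGraph.mem_neighborFinset] at hu ⊢
      exact (e.symm i).map_adj_iff.2 hu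
    · intro u _ w _ h
      exact (e.symm i).injective h
    · intro w hw
      refine ⟨(e.symm i).symm w, ?_, by simp⟩
      rw [SimpleGraph.mem_neighborFinset] at hw ⊢
      rw [← (e.symm i).map_adj_iff]
      simpa using hw
    · intro u _
      rfl
  obtain ⟨w, hw⟩ := Function.ne_iff.1 hx
  have hqw : ∀ v, ‖q v‖ ≠ 0 := fun v h => by
    rw [hconst v w] at h
    have h0 := hsq w
    rw [h, zero_pow two_ne_zero, eq_comm, Finset.sum_eq_zero_iff_of_nonneg fun _ _ => sq_nonneg _]
      at h0
    exact hw (by simpa using h0 (RelIso.refl _) (Finset.mem_univ _))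
  refine ⟨_, fun v => ‖q w‖⁻¹ • q v, fun v => ?_, fun v => ?_⟩
  · rw [norm_smul, norm_inv, norm_norm, hconst w v, inv_mul_cancel₀ (hqw v)]
  · rw [← Finset.smul_sum, heig, smul_comm]

/-- The vertices at which `f` is positive while it is nonpositive on the neighbours. -/
noncomputable def positivePeaks (f : V → ℝ) : Finset V :=
  {v | 0 < f v ∧ ∀ u ∈ G.neighborFinset v, f u ≤ 0}

theorem mem_positivePeaks {f : V → ℝ} {v : V} :
    v ∈ positivePeaks G f ↔ 0 < f v ∧ ∀ u ∈ G.neighborFinset v, f u ≤ 0 := by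
  simp [positivePeaks]

theorem not_adj_of_mem_positivePeaks {f : V → ℝ} {u v : V} (hu : u ∈ positivePeaks G f)
    (hv : v ∈ positivePeaks G f) : ¬ G.Adj u v := fun h =>
  (((mem_positivePeaks G).1 hu).2 v (by simpa using h)).not_gt ((mem_positivePeaks G).1 hv).1

theorem exists_mul_card_le_card_positivePeaks {Ω : Type*} [MeasurableSpace Ω] (μ : Measure Ω)
    [IsProbabilityMeasure μ] {X : V → Ω → ℝ} (hX : ∀ v, Measurable (X v)) {c : ℝ}
    (hc : ∀ v, c ≤ μ.real {ω | 0 < X v ω} -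
      ∑ u ∈ G.neighborFinset v, μ.real {ω | 0 < X u ω ∧ 0 < X v ω}) :
    ∃ ω, c * (Fintype.card V : ℝ) ≤ ((positivePeaks G fun v => X v ω).card : ℝ) := by
  let A : V → Set Ω := fun v => {ω | v ∈ positivePeaks G fun w => X w ω}
  have hA : ∀ v, MeasurableSet (A v) := fun v => by
    have : A v = {ω | 0 < X v ω} ∩ ⋂ u ∈ G.neighborFinset v, {ω | X u ω ≤ 0} := by
      ext ω
      simp [A, mem_positivePeaks]
    rw [this]
    exact (measurableSet_lt measurable_const (hX v)).inter
      (Finset.measurableSet_biInter _ fun u _ => measurableSet_le (hX u) measurable_const)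
  have hbound : ∀ v, c ≤ μ.real (A v) := fun v => by
    have hsub : {ω | 0 < X v ω} ⊆
        A v ∪ ⋃ u ∈ G.neighborFinset v, {ω | 0 < X u ω ∧ 0 < X v ω} := by
      intro ω hω
      by_cases h : ∀ u ∈ G.neighborFinset v, X u ω ≤ 0
      · exact Or.inl ((mem_positivePeaks G).2 ⟨hω, h⟩)
      · push Not at h
        obtain ⟨u, hu, hpos⟩ := h
        exact Or.inr (mem_iUnion₂.2 ⟨u, hu, hpos, hω⟩)
    have h1 := (measureReal_mono (μ := μ) hsub).trans (measureReal_union_le _ _)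
    have h2 := measureReal_biUnion_finset_le (μ := μ) (G.neighborFinset v)
      fun u => {ω | 0 < X u ω ∧ 0 < X v ω}
    linarith [hc v]
  have hint : ∀ v, Integrable ((A v).indicator fun _ => (1 : ℝ)) μ := fun v =>
    (integrable_const 1).indicator (hA v)
  obtain ⟨ω, hω⟩ := exists_integral_le (integrable_finsetSum Finset.univ fun v _ => hint v)
  refine ⟨ω, ?_⟩
  rw [integral_finsetSum _ fun v _ => hint v] at hω
  simp only [integral_indicator_const _ (hA _), smul_eq_mul, mul_one] at hω
  calc c * (Fintype.card V : ℝ) = ∑ _v : V, c := by simp [mul_comm]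
    _ ≤ ∑ v, μ.real (A v) := Finset.sum_le_sum fun v _ => hbound v
    _ ≤ ∑ v, (A v).indicator (fun _ => (1 : ℝ)) ω := hω
    _ = ((positivePeaks G fun v => X v ω).card : ℝ) := by
        classical simp [A, indicator_apply]

end Graph

/-- A finite, `d`-regular (`d ≥ 3`), vertex-transitive simple graph with
least adjacency-matrix eigenvalue `lam` has independence ratio at least
`1/2 - (1/3)·√(d·(lam + d))`: there is an independent set of at least that proportion
of the vertices. -/
theorem independence_ratio_ge_of_vertex_transitive
    {V : Type*} [Fintype V] [DecidableEq V] (G : SimpleGraph V) [DecidableRel G.Adj]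
    (d : ℕ) (hd : 3 ≤ d) (hreg : G.IsRegularOfDegree d)
    (htrans : ∀ u v : V, ∃ φ : G ≃g G, φ u = v)
    (lam : ℝ)
    (hlam : IsLeast {μ : ℝ | ∃ x : V → ℝ, x ≠ 0 ∧ G.adjMatrix ℝ *ᵥ x = μ • x} lam) :
    ∃ S : Finset V, (∀ u ∈ S, ∀ v ∈ S, ¬ G.Adj u v) ∧
      (1 / 2 - (1 / 3) * Real.sqrt (d * (lam + d))) * (Fintype.card V : ℝ) ≤ (S.card : ℝ) := by
  have hd' : (3 : ℝ) ≤ d := by exact_mod_cast hd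
  rcases le_or_gt (9 / 4) (d * (lam + d)) with hbig | hsmall
  · refine ⟨∅, by simp, ?_⟩
    have : 3 / 2 ≤ √(d * (lam + d)) := Real.le_sqrt_of_sq_le (by linarith)
    rw [Finset.card_empty, Nat.cast_zero]
    exact mul_nonpos_of_nonpos_of_nonneg (by linarith) (Nat.cast_nonneg _)
  obtain ⟨x, hx, hxlam⟩ := hlam.1
  obtain ⟨n, p, hp, hsum⟩ := exists_unit_vectors_sum_neighbors_eq G htrans hx hxlam
  have hdefect : ∀ v, ∑ u ∈ G.neighborFinset v, (1 + ⟪p u, p v⟫) = lam + d := fun v => by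
    rw [Finset.sum_add_distrib, ← sum_inner, hsum, inner_smul_left, real_inner_self_eq_norm_sq,
      hp, Finset.sum_const, SimpleGraph.card_neighborFinset_eq_degree, hreg v]
    simp [add_comm]
  have hnonneg : ∀ u v, 0 ≤ 1 + ⟪p u, p v⟫ := fun u v => by
    have := neg_le_of_abs_le (abs_real_inner_le_norm (p u) (p v))
    rw [hp, hp] at this
    linarith
  have hsqrt : ∀ v, ∑ u ∈ G.neighborFinset v, √(1 + ⟪p u, p v⟫) ≤ √(d * (lam + d)) := fun v => by
    refine Real.le_sqrt_of_sq_le ?_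
    have h := sq_sum_le_card_mul_sum_sq (s := G.neighborFinset v)
      (f := fun u => √(1 + ⟪p u, p v⟫))
    simpa only [Real.sq_sqrt (hnonneg _ _), hdefect, SimpleGraph.card_neighborFinset_eq_degree,
      hreg v] using h
  have hneg : ∀ v, ∀ u ∈ G.neighborFinset v, ⟪p u, p v⟫ ≤ 0 := fun v u hu => by
    have h := Finset.single_le_sum (f := fun u => 1 + ⟪p u, p v⟫) (fun u _ => hnonneg u v) hu
    rw [hdefect] at h
    have : lam + d ≤ 1 := by nlinarith
    linarith
  obtain ⟨g, hg⟩ := exists_mul_card_le_card_positivePeaks G (stdGaussian (EuclideanSpace ℝ (Fin n)))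
    (X := fun v g => ⟪p v, g⟫) (fun v => by fun_prop)
    (c := 1 / 2 - (1 / 3) * √(d * (lam + d))) fun v => by
      rw [stdGaussian_inner_pos (norm_ne_zero_iff.1 (by simp [hp]))]
      have h := Finset.sum_le_sum fun u hu =>
        stdGaussian_inner_pos_inner_pos_le (hp u) (hp v) (hneg v u hu)
      rw [← Finset.sum_div] at h
      linarith [hsqrt v]
  exact ⟨_, fun u hu v hv => not_adj_of_mem_positivePeaks G hu hv, hg⟩
end

section
/- Let G be a finite, d-regular (d ≥ 3), arc-transitive simple graph and let λ_min be the least eigenvalue of its adjacency matrix. Then the independence ratio of G is at least 1/2 − (1/3)·√(λ_min + d). -/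
open Matrix MeasureTheory ProbabilityTheory

open Real in
lemma gaussianReal_real_Ioi_ge {m : ℝ} (hm : 0 ≤ m) :
    1 / 2 - m / √(2 * π) ≤ (gaussianReal 0 1).real (Set.Ioi m) := by
  have h01 : (gaussianReal 0 1).real (Set.Ioi 0) = 1 / 2 := by
    have hneg : (gaussianReal 0 1).real (Set.Iio 0) = (gaussianReal 0 1).real (Set.Ioi 0) := by
      have := gaussianReal_map_neg (μ := 0) (v := 1)
      rw [neg_zero] at this
      conv_rhs => rw [← this]
      rw [map_measureReal_apply measurable_neg measurableSet_Ioi]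
      congr 1
      ext x
      simp
    have : NullSingletonClass (gaussianReal 0 1) := nullSingletonClass_gaussianReal one_ne_zero
    have hIic : (gaussianReal 0 1).real (Set.Iic 0) = (gaussianReal 0 1).real (Set.Iio 0) :=
      measureReal_congr Iio_ae_eq_Iic.symm
    have := probReal_compl_eq_one_sub (μ := gaussianReal 0 1) (s := Set.Ioi 0) measurableSet_Ioi
    rw [Set.compl_Ioi, hIic, hneg] at this
    linarith
  have hIoc : (gaussianReal 0 1).real (Set.Ioc 0 m) ≤ m / √(2 * π) := by
    rw [measureReal_def, gaussianReal_apply_eq_integral 0 one_ne_zero,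
      ENNReal.toReal_ofReal (setIntegral_nonneg measurableSet_Ioc
        fun x _ => gaussianPDFReal_nonneg 0 1 x)]
    calc ∫ x in Set.Ioc 0 m, gaussianPDFReal 0 1 x
        ≤ ∫ _ in Set.Ioc 0 m, (√(2 * π))⁻¹ := by
          refine setIntegral_mono_on (integrable_gaussianPDFReal 0 1).integrableOn
            (integrableOn_const (by simp)) measurableSet_Ioc fun x _ => ?_
          simp only [gaussianPDFReal, NNReal.coe_one, mul_one, sub_zero]
          exact mul_le_of_le_one_right (by positivity) (exp_le_one_iff.2 (by nlinarith [sq_nonneg x]))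
      _ = m / √(2 * π) := by simp [hm, div_eq_mul_inv]
  have hU : Set.Ioi (0 : ℝ) = Set.Ioc 0 m ∪ Set.Ioi m := (Set.Ioc_union_Ioi_eq_Ioi hm).symm
  have := measureReal_union_le (μ := gaussianReal 0 1) (Set.Ioc 0 m) (Set.Ioi m)
  rw [← hU, h01] at this
  linarith

open Real in
lemma ProbabilityTheory.IndepFun.measureReal_lt_ge {Ω : Type*} [MeasurableSpace Ω] {P : Measure Ω}
    [IsProbabilityMeasure P] {X M : Ω → ℝ} (hX : Measurable X) (hM : Measurable M)
    (hlaw : P.map X = gaussianReal 0 1) (hMX : IndepFun M X P) (hM0 : ∀ ω, 0 ≤ M ω)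
    (hMi : Integrable M P) :
    1 / 2 - P[M] / √(2 * π) ≤ P.real {ω | M ω < X ω} := by
  have hpair := (indepFun_iff_map_prod_eq_prod_map_map hM.aemeasurable hX.aemeasurable).1 hMX
  have := Measure.isProbabilityMeasure_map (μ := P) hM.aemeasurable
  have hset : MeasurableSet {p : ℝ × ℝ | p.1 < p.2} := measurableSet_lt measurable_fst measurable_snd
  have h1 : P.real {ω | M ω < X ω} = ∫ ω, (gaussianReal 0 1).real (Set.Ioi (M ω)) ∂P := by
    have : P.real {ω | M ω < X ω} = (P.map fun ω => (M ω, X ω)).real {p | p.1 < p.2} := by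
      rw [map_measureReal_apply (hM.prodMk hX) hset]; rfl
    rw [this, hpair, hlaw, measureReal_def, Measure.prod_apply hset,
      lintegral_map (measurable_measure_prodMk_left hset) hM]
    exact (integral_toReal ((measurable_measure_prodMk_left hset).comp hM).aemeasurable
      (ae_of_all _ fun _ => measure_lt_top _ _)).symm
  have hmeas : Measurable fun ω => (gaussianReal 0 1).real (Set.Ioi (M ω)) :=
    ((measurable_measure_prodMk_left (ν := gaussianReal 0 1) hset).ennreal_toReal).comp hM
  rw [h1]
  calc 1 / 2 - P[M] / √(2 * π) = ∫ ω, (1 / 2 - M ω / √(2 * π)) ∂P := by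
        rw [integral_sub (integrable_const _) (hMi.div_const _), integral_const, probReal_univ, one_smul, integral_div]
    _ ≤ _ := by
        refine integral_mono ((integrable_const _).sub (hMi.div_const _)) ?_
          fun ω => gaussianReal_real_Ioi_ge (hM0 ω)
        refine Integrable.of_bound hmeas.aestronglyMeasurable 1 (ae_of_all _ fun ω => ?_)
        rw [Real.norm_of_nonneg measureReal_nonneg]
        exact measureReal_le_one

section stdGaussian

open scoped RealInnerProductSpace

variable {E : Type*} [NormedAddCommGroup E] [InnerProductSpace ℝ E] [FiniteDimensional ℝ E]
  [MeasurableSpace E] [BorelSpace E]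

lemma covariance_inner_stdGaussian (x y : E) :
    cov[fun ω => ⟪x, ω⟫, fun ω => ⟪y, ω⟫; stdGaussian E] = ⟪x, y⟫ := by
  rw [← covarianceBilin_apply_eq_cov IsGaussian.memLp_two_id, covarianceBilin_stdGaussian]
  rfl

lemma hasGaussianLaw_inner_stdGaussian (x : E) :
    HasGaussianLaw (fun ω => ⟪x, ω⟫) (stdGaussian E) :=
  IsGaussian.hasGaussianLaw_id.map_fun (innerSL ℝ x)

lemma integral_inner_stdGaussian (x : E) : ∫ ω, ⟪x, ω⟫ ∂stdGaussian E = 0 :=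
  integral_strongDual_stdGaussian (innerSL ℝ x)

lemma integral_inner_sq_stdGaussian (x : E) : ∫ ω, ⟪x, ω⟫ ^ 2 ∂stdGaussian E = ‖x‖ ^ 2 := by
  rw [← real_inner_self_eq_norm_sq, ← covariance_inner_stdGaussian, covariance_self (by fun_prop),
    variance_of_integral_eq_zero (by fun_prop) (integral_inner_stdGaussian x)]

lemma integrable_inner_sq_stdGaussian (x : E) :
    Integrable (fun ω => ⟪x, ω⟫ ^ 2) (stdGaussian E) :=
  (hasGaussianLaw_inner_stdGaussian x).memLp_two.integrable_sq

lemma map_inner_stdGaussian {x : E} (hx : ‖x‖ = 1) :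
    (stdGaussian E).map (fun ω => ⟪x, ω⟫) = gaussianReal 0 1 := by
  rw [(hasGaussianLaw_inner_stdGaussian x).map_eq_gaussianReal, integral_inner_stdGaussian,
    ← covariance_self (by fun_prop), covariance_inner_stdGaussian, real_inner_self_eq_norm_sq, hx]
  simp

lemma indepFun_inner_stdGaussian {ι : Type*} [Finite ι] {x : E} {z : ι → E}
    (h : ∀ i, ⟪x, z i⟫ = 0) :
    IndepFun (fun ω i => ⟪z i, ω⟫) (fun ω => ⟪x, ω⟫) (stdGaussian E) := by
  have := Fintype.ofFinite ι
  have hlaw : HasGaussianLaw (fun ω => (fun i => ⟪z i, ω⟫, fun _ : Unit => ⟪x, ω⟫))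
      (stdGaussian E) :=
    IsGaussian.hasGaussianLaw_id.map_fun
      ((ContinuousLinearMap.pi fun i => innerSL ℝ (z i)).prod
        (ContinuousLinearMap.pi fun _ : Unit => innerSL ℝ x))
  have hind := hlaw.indepFun_of_covariance_eval (X := fun i ω => ⟪z i, ω⟫)
    (Y := fun _ ω => ⟪x, ω⟫) fun i _ => by
      rw [covariance_inner_stdGaussian, real_inner_comm, h]
  exact hind.comp measurable_id (measurable_pi_apply ())

lemma sq_le_of_sum_eq_zero {ι : Type*} [Fintype ι] {z : ι → ℝ} (hz : ∑ i, z i = 0) (i : ι) :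
    Fintype.card ι * z i ^ 2 ≤ (Fintype.card ι - 1) * ∑ j, z j ^ 2 := by
  classical
  have h1 := Finset.add_sum_erase Finset.univ z (Finset.mem_univ i)
  have h2 := Finset.add_sum_erase Finset.univ (fun j => z j ^ 2) (Finset.mem_univ i)
  have h3 := sq_sum_le_card_mul_sum_sq (s := Finset.univ.erase i) (f := z)
  have hpos : 1 ≤ Fintype.card ι := Fintype.card_pos_iff.2 ⟨i⟩
  rw [Finset.card_erase_of_mem (Finset.mem_univ i), Finset.card_univ, Nat.cast_sub hpos,
    Nat.cast_one, show ∑ j ∈ Finset.univ.erase i, z j = - z i by linarith] at h3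
  rw [← h2]
  linarith

open Real in
lemma stdGaussian_real_forall_inner_lt_ge {ι : Type*} [Fintype ι] [Nonempty ι] {a : E} {b : ι → E}
    {c : ℝ} (ha : ‖a‖ = 1) (hb : ∀ i, ‖b i‖ = 1) (hab : ∀ i, ⟪a, b i⟫ = c) (hc : c < 1)
    (hsum : ∑ i, b i = (Fintype.card ι * c) • a) :
    1 / 2 - √((Fintype.card ι - 1) * (1 - c ^ 2)) / (1 - c) / √(2 * π) ≤
      (stdGaussian E).real {ω | ∀ i, ⟪b i, ω⟫ < ⟪a, ω⟫} := by
  set z : ι → E := fun i => b i - c • a with hz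
  set n : ℝ := (Fintype.card ι : ℝ) with hn
  have hn1 : 1 ≤ n := Nat.one_le_cast.2 Fintype.card_pos
  have hc' : 0 < 1 - c := by linarith
  have haz : ∀ i, ⟪a, z i⟫ = 0 := fun i => by
    simp [hz, inner_sub_right, inner_smul_right, hab, ha]
  have hzn : ∀ i, ‖z i‖ ^ 2 = 1 - c ^ 2 := fun i => by
    rw [hz, norm_sub_sq_real, norm_smul, inner_smul_right, real_inner_comm, hab, ha, hb,
      Real.norm_eq_abs, mul_one, sq_abs]
    ring
  have hzsum : ∀ ω, ∑ i, ⟪z i, ω⟫ = 0 := fun ω => by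
    rw [← sum_inner, hz, Finset.sum_sub_distrib, hsum, Finset.sum_const, Finset.card_univ,
      ← Nat.cast_smul_eq_nsmul ℝ, smul_smul, sub_self, inner_zero_left]
  set g : (ι → ℝ) → ℝ := fun y => √((n - 1) / n * ∑ i, y i ^ 2) / (1 - c) with hg
  have hgm : Measurable g := by fun_prop
  set N : E → ℝ := fun ω => √((n - 1) / n * ∑ i, ⟪z i, ω⟫ ^ 2) with hN
  set M : E → ℝ := fun ω => g fun i => ⟪z i, ω⟫ with hM
  have hMN : ∀ ω, M ω = N ω / (1 - c) := fun ω => rfl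
  have hN2 : ∀ ω, N ω ^ 2 = (n - 1) / n * ∑ i, ⟪z i, ω⟫ ^ 2 := fun ω =>
    Real.sq_sqrt (mul_nonneg (div_nonneg (by linarith) (by linarith))
      (Finset.sum_nonneg fun _ _ => sq_nonneg _))
  have hNm : Measurable N := by fun_prop
  have hNL : MemLp N 2 (stdGaussian E) := by
    rw [memLp_two_iff_integrable_sq hNm.aestronglyMeasurable]
    simp_rw [hN2]
    exact (integrable_finsetSum _ fun i _ => integrable_inner_sq_stdGaussian (z i)).const_mul _
  have hNi : Integrable N (stdGaussian E) := hNL.integrable one_le_two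
  have hNint : ∫ ω, N ω ∂stdGaussian E ≤ √((n - 1) * (1 - c ^ 2)) := by
    refine Real.le_sqrt_of_sq_le ?_
    have hvar := variance_nonneg N (stdGaussian E)
    rw [variance_eq_sub hNL] at hvar
    have hsq : ∫ ω, (N ^ 2) ω ∂stdGaussian E = (n - 1) * (1 - c ^ 2) := by
      simp_rw [Pi.pow_apply, hN2]
      rw [integral_const_mul, integral_finsetSum _ fun i _ => integrable_inner_sq_stdGaussian (z i)]
      simp_rw [integral_inner_sq_stdGaussian, hzn, Finset.sum_const, Finset.card_univ,
        nsmul_eq_mul, ← hn]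
      field_simp
    linarith
  have hMX : IndepFun M (fun ω => ⟪a, ω⟫) (stdGaussian E) :=
    (indepFun_inner_stdGaussian haz).comp hgm measurable_id
  have key := hMX.measureReal_lt_ge (by fun_prop) (by fun_prop) (map_inner_stdGaussian ha)
    (fun ω => div_nonneg (Real.sqrt_nonneg _) hc'.le) (hNi.div_const _)
  have hMint : ∫ ω, M ω ∂stdGaussian E ≤ √((n - 1) * (1 - c ^ 2)) / (1 - c) := by
    simp_rw [hMN, integral_div]
    gcongr
  refine le_trans (by gcongr) (key.trans (measureReal_mono ?_))
  intro ω hω i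
  have h1 : N ω < (1 - c) * ⟪a, ω⟫ := by
    rw [mul_comm]; exact (div_lt_iff₀ hc').1 hω
  have h2 : ⟪z i, ω⟫ ≤ N ω := by
    refine Real.le_sqrt_of_sq_le ?_
    rw [div_mul_eq_mul_div, le_div_iff₀ (by linarith), mul_comm]
    exact sq_le_of_sum_eq_zero (hzsum ω) i
  have h3 : ⟪z i, ω⟫ = ⟪b i, ω⟫ - c * ⟪a, ω⟫ := by
    rw [hz, inner_sub_left, real_inner_smul_left]
  linarith

end stdGaussian

lemma exists_finset_integral_le_card {V Ω : Type*} [Fintype V] [MeasurableSpace Ω] {P : Measure Ω}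
    [IsProbabilityMeasure P] {A : V → Set Ω} (hA : ∀ v, MeasurableSet (A v)) {q : ℝ}
    (hq : ∀ v, q ≤ P.real (A v)) :
    ∃ (ω : Ω) (S : Finset V), (∀ v, v ∈ S ↔ ω ∈ A v) ∧ q * Fintype.card V ≤ S.card := by
  classical
  have hi : ∀ v, Integrable ((A v).indicator (1 : Ω → ℝ)) P := fun v =>
    (integrable_const 1).indicator (hA v)
  have hint : Integrable (fun ω => ∑ v, (A v).indicator (1 : Ω → ℝ) ω) P :=
    integrable_finsetSum _ fun v _ => hi v
  obtain ⟨ω, hω⟩ := exists_integral_le hint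
  refine ⟨ω, Finset.univ.filter fun v => ω ∈ A v, by simp, ?_⟩
  rw [integral_finsetSum _ fun v _ => hi v] at hω
  simp_rw [integral_indicator_one (hA _)] at hω
  have hcard : ∑ v, (A v).indicator (1 : Ω → ℝ) ω = (Finset.univ.filter fun v => ω ∈ A v).card := by
    simp [Set.indicator_apply]
  calc q * Fintype.card V = ∑ _v : V, q := by simp [mul_comm]
    _ ≤ ∑ v, P.real (A v) := Finset.sum_le_sum fun v _ => hq v
    _ ≤ _ := hω.trans hcard.le

namespace SimpleGraph

open scoped RealInnerProductSpace

variable {V : Type*} [Fintype V] {G : SimpleGraph V} [DecidableRel G.Adj]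

/-- An eigenvector of an arc-transitive graph, averaged over the automorphism group, places the
vertices on a Euclidean sphere so that adjacent vertices have constant inner product. -/
lemma exists_euclidean_representation [Fintype (G ≃g G)] {d : ℕ} (hd : d ≠ 0)
    (hreg : G.IsRegularOfDegree d)
    (harc : ∀ u₁ v₁ u₂ v₂ : V, G.Adj u₁ v₁ → G.Adj u₂ v₂ → ∃ φ : G ≃g G, φ u₁ = u₂ ∧ φ v₁ = v₂)
    {lam : ℝ} {x : V → ℝ} (hx : x ≠ 0) (hev : G.adjMatrix ℝ *ᵥ x = lam • x) :
    ∃ b : V → EuclideanSpace ℝ (G ≃g G), (∀ v, ‖b v‖ = 1) ∧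
      (∀ u v, G.Adj u v → ⟪b u, b v⟫ = lam / d) ∧
      ∀ v, ∑ u ∈ G.neighborFinset v, b u = lam • b v := by
  have hnbr : ∀ v, ∃ u, G.Adj v u := fun v => by
    rw [← G.degree_pos_iff_exists_adj, hreg v]
    exact Nat.pos_of_ne_zero hd
  have htrans : ∀ u v, ∃ φ : G ≃g G, φ u = v := fun u v => by
    obtain ⟨u', hu⟩ := hnbr u
    obtain ⟨v', hv⟩ := hnbr v
    obtain ⟨φ, h, -⟩ := harc u u' v v' hu hv
    exact ⟨φ, h⟩
  let a : V → EuclideanSpace ℝ (G ≃g G) := fun v => WithLp.toLp 2 fun φ => x (φ v)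
  have ha_inner : ∀ u v, ⟪a u, a v⟫ = ∑ φ : G ≃g G, x (φ u) * x (φ v) := fun u v => by
    simp [a, PiLp.inner_apply, mul_comm]
  have ha_inv : ∀ (ψ : G ≃g G) (u v), ⟪a (ψ u), a (ψ v)⟫ = ⟪a u, a v⟫ := fun ψ u v => by
    rw [ha_inner, ha_inner]
    exact Fintype.sum_equiv (Equiv.mulRight ψ) _ _ fun φ => rfl
  have ha_sum : ∀ v, ∑ u ∈ G.neighborFinset v, a u = lam • a v := fun v => by
    ext φ
    have h := congrFun hev (φ v)
    rw [adjMatrix_mulVec_apply] at h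
    have hmap : ∑ u ∈ G.neighborFinset (φ v), x u = ∑ u ∈ G.neighborFinset v, x (φ u) := by
      symm
      refine Finset.sum_bij (fun u _ => φ u) ?_ ?_ ?_ ?_
      · intro u hu
        simpa [φ.map_adj_iff] using hu
      · intro u _ w _ h
        exact φ.injective h
      · intro w hw
        exact ⟨φ.symm w, by rw [mem_neighborFinset, ← φ.map_adj_iff]; simpa using hw, by simp⟩
      · intro u _
        rfl
    rw [hmap] at h
    simpa [a] using h
  obtain ⟨w, hw⟩ := Function.ne_iff.1 hx
  have ha_norm : ∀ v, ‖a v‖ = ‖a w‖ := fun v => by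
    obtain ⟨ψ, rfl⟩ := htrans w v
    rw [@norm_eq_sqrt_real_inner _ _ _ (a (ψ w)), ha_inv, ← norm_eq_sqrt_real_inner]
  have hr : ‖a w‖ ≠ 0 := fun h => hw (by
    have := congrArg (fun y : EuclideanSpace ℝ (G ≃g G) => y 1) (norm_eq_zero.1 h)
    simpa [a] using this)
  have ha_adj : ∀ u v, G.Adj u v → ⟪a u, a v⟫ = lam / d * ‖a w‖ ^ 2 := fun u v huv => by
    have hconst : ∀ u' ∈ G.neighborFinset v, ⟪a u', a v⟫ = ⟪a u, a v⟫ := fun u' hu' => by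
      obtain ⟨ψ, rfl, hψ⟩ := harc u v u' v huv ((G.mem_neighborFinset _ _).1 hu').symm
      conv_lhs => rw [← hψ]
      exact ha_inv ψ u v
    have h := congrArg (fun y => ⟪y, a v⟫) (ha_sum v)
    simp only [sum_inner, real_inner_smul_left] at h
    rw [Finset.sum_congr rfl hconst, Finset.sum_const, card_neighborFinset_eq_degree, hreg v,
      nsmul_eq_mul, real_inner_self_eq_norm_sq, ha_norm] at h
    have : (d : ℝ) ≠ 0 := Nat.cast_ne_zero.2 hd
    field_simp
    linarith
  refine ⟨fun v => ‖a w‖⁻¹ • a v, fun v => ?_, fun u v huv => ?_, fun v => ?_⟩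
  · rw [norm_smul, norm_inv, norm_norm, ha_norm v, inv_mul_cancel₀ hr]
  · rw [real_inner_smul_left, real_inner_smul_right, ha_adj u v huv]
    field_simp
  · rw [← Finset.smul_sum, ha_sum, smul_comm]

end SimpleGraph

open Real in
lemma half_sub_third_sqrt_le {d lam : ℝ} (hd : 3 ≤ d) (h0 : 0 ≤ lam + d)
    (h1 : lam + d ≤ 9 / 4) :
    1 / 2 - 1 / 3 * √(lam + d) ≤
      1 / 2 - √((d - 1) * (1 - (lam / d) ^ 2)) / (1 - lam / d) / √(2 * π) := by
  have hc : 0 < d - lam := by linarith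
  have hd0 : 0 < d := by linarith
  have hc' : 1 - lam / d = (d - lam) / d := by field_simp
  have hpos : 0 < 1 - lam / d := by rw [hc']; positivity
  have hsq : (d - 1) * (1 - (lam / d) ^ 2) ≤
      (lam + d) * (1 / 9 * (1 - lam / d) ^ 2 * (2 * π)) := by
    have hfac : (d - 1) * (1 - (lam / d) ^ 2) = (lam + d) * (d - lam) / d ^ 2 * (d - 1) := by
      field_simp
      ring
    have hfac' : (lam + d) * (1 / 9 * (1 - lam / d) ^ 2 * (2 * π)) =
        (lam + d) * (d - lam) / d ^ 2 * (1 / 9 * (d - lam) * (2 * π)) := by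
      rw [hc']
      field_simp
    rw [hfac, hfac']
    gcongr
    nlinarith [pi_gt_three]
  rw [div_div, sub_le_sub_iff_left, div_le_iff₀ (by positivity)]
  refine (sqrt_le_sqrt hsq).trans_eq ?_
  rw [sqrt_mul h0, sqrt_mul (by positivity), sqrt_mul (by positivity), sqrt_sq hpos.le,
    show √(1 / 9 : ℝ) = 1 / 3 by rw [show (1 / 9 : ℝ) = (1 / 3) ^ 2 by norm_num]; simp]
  ring


/-- A finite, `d`-regular (`d ≥ 3`), arc-transitive simple graph with
least adjacency-matrix eigenvalue `lam` has independence ratio at least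
`1/2 - (1/3)·√(lam + d)`. -/
theorem independence_ratio_ge_of_arc_transitive
    {V : Type*} [Fintype V] [DecidableEq V] (G : SimpleGraph V) [DecidableRel G.Adj]
    (d : ℕ) (hd : 3 ≤ d) (hreg : G.IsRegularOfDegree d)
    (harc : ∀ u₁ v₁ u₂ v₂ : V, G.Adj u₁ v₁ → G.Adj u₂ v₂ →
      ∃ φ : G ≃g G, φ u₁ = u₂ ∧ φ v₁ = v₂)
    (lam : ℝ)
    (hlam : IsLeast {μ : ℝ | ∃ x : V → ℝ, x ≠ 0 ∧ G.adjMatrix ℝ *ᵥ x = μ • x} lam) :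
    ∃ S : Finset V, (∀ u ∈ S, ∀ v ∈ S, ¬ G.Adj u v) ∧
      (1 / 2 - (1 / 3) * Real.sqrt (lam + d)) * (Fintype.card V : ℝ) ≤ (S.card : ℝ) := by
  by_cases hlarge : 9 / 4 < lam + d
  · refine ⟨∅, by simp, ?_⟩
    have : 3 / 2 ≤ √(lam + d) := Real.le_sqrt_of_sq_le (by linarith)
    rw [Finset.card_empty, Nat.cast_zero]
    exact mul_nonpos_of_nonpos_of_nonneg (by linarith) (Nat.cast_nonneg _)
  obtain ⟨x, hx, hev⟩ := hlam.1
  have : Finite (G ≃g G) :=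
    Finite.of_injective (fun φ : G ≃g G => (φ : V → V)) DFunLike.coe_injective
  have := Fintype.ofFinite (G ≃g G)
  obtain ⟨b, hb, hadj, hsum⟩ :=
    SimpleGraph.exists_euclidean_representation (by omega) hreg harc hx hev
  have hd3 : (3 : ℝ) ≤ d := by exact_mod_cast hd
  obtain ⟨v, -⟩ := Function.ne_iff.1 hx
  have hnbr : ∀ v, ∃ u, G.Adj v u := fun v => by
    rw [← G.degree_pos_iff_exists_adj, hreg v]
    omega
  have h0 : 0 ≤ lam + d := by
    obtain ⟨u, hu⟩ := hnbr v
    have h := neg_le_of_abs_le (abs_real_inner_le_norm (b v) (b u))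
    rw [hb, hb, hadj v u hu, mul_one, le_div_iff₀ (by linarith)] at h
    linarith
  have hprob : ∀ v, 1 / 2 - 1 / 3 * √(lam + d) ≤
      (stdGaussian (EuclideanSpace ℝ (G ≃g G))).real
        {ω | ∀ u : G.neighborSet v, inner ℝ (b u) ω < inner ℝ (b v) ω} := fun v => by
    have hcard : (Fintype.card (G.neighborSet v) : ℝ) = d := by
      rw [G.card_neighborSet_eq_degree, hreg v]
    have : Nonempty (G.neighborSet v) := let ⟨u, hu⟩ := hnbr v; ⟨u, hu⟩
    have h := stdGaussian_real_forall_inner_lt_ge (b := fun u : G.neighborSet v => b u)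
      (c := lam / d) (hb v) (fun u => hb u) (fun u => hadj v u u.2)
      ((div_lt_one (by linarith)).2 (by linarith)) (by
        rw [hcard, mul_div_cancel₀ _ (by linarith), ← hsum v]
        exact (Finset.sum_subtype _ (fun u => by simp) b).symm)
    rw [hcard] at h
    exact (half_sub_third_sqrt_le hd3 h0 (not_lt.1 hlarge)).trans h
  obtain ⟨ω, S, hS, hcard⟩ := exists_finset_integral_le_card (fun v => by
    rw [Set.ofPred_forall]
    exact MeasurableSet.iInter fun u => measurableSet_lt (by fun_prop) (by fun_prop)) hprob
  refine ⟨S, fun u hu v hv huv => ?_, hcard⟩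
  exact lt_asymm ((hS u).1 hu ⟨v, huv⟩) ((hS v).1 hv ⟨u, huv.symm⟩)
end

section
/- Let G be a finite, 4-regular, arc-transitive simple graph and let λ_min be the least eigenvalue of its adjacency matrix. Then the independence ratio of G is at least 1/2 − (1/4)·√(λ_min + 4). -/
open Matrix
open Real MeasureTheory InnerProductSpace

/-- Two open half-circles at angular distance `θ` meet in an arc of length `π - θ`. -/
theorem volume_cos_pos_inter_cos_sub_pos_le {θ : ℝ} (hθπ : θ ≤ π) (β : ℝ) :
    volume ({t : ℝ | 0 < cos (t - β) ∧ 0 < cos (t - θ - β)} ∩ Set.Ioc 0 (0 + 2 * π)) ≤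
      ENNReal.ofReal (π - θ) := by
  have hmeas : MeasurableSet {t : ℝ | 0 < cos (t - β) ∧ 0 < cos (t - θ - β)} :=
    ((isOpen_lt (by fun_prop) (by fun_prop)).and
      (isOpen_lt (by fun_prop) (by fun_prop))).measurableSet
  rw [(isAddFundamentalDomain_Ioc two_pi_pos 0 volume).measure_set_eq
    (isAddFundamentalDomain_Ioc two_pi_pos (β - π / 2) volume) hmeas]
  · calc
      _ ≤ volume (Set.Ioc (β + θ - π / 2) (β + π / 2)) := by
        refine measure_mono ?_
        rintro t ⟨⟨h1, h2⟩, h3, h4⟩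
        have h5 : t ≤ β + π / 2 := by
          by_contra! h
          exact absurd h1 (not_lt.mpr
            (cos_nonpos_of_pi_div_two_le_of_le (by linarith) (by linarith)))
        refine ⟨?_, h5⟩
        by_contra! h
        rw [← cos_neg] at h2
        exact absurd h2 (not_lt.mpr
          (cos_nonpos_of_pi_div_two_le_of_le (by linarith) (by linarith)))
      _ = _ := by rw [Real.volume_Ioc]; congr 1; ring
  · rintro ⟨_, n, rfl⟩
    ext t
    have h (x : ℝ) : cos (n • (2 * π) + t - x) = cos (t - x) := by
      rw [← cos_add_int_mul_two_pi (t - x) n]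
      congr 1
      simp only [zsmul_eq_mul]
      ring
    simp only [Set.mem_preimage, Set.mem_ofPred_eq, AddSubgroup.vadd_def, vadd_eq_add, sub_sub, h]

/-- The arc bound for two sinusoids differing by a phase shift `θ`. -/
theorem volume_linear_cos_sin_pos_le {θ : ℝ} (hθπ : θ ≤ π) (a b : ℝ) :
    volume ({t : ℝ | 0 < a * cos t + b * sin t ∧ 0 < a * cos (t - θ) + b * sin (t - θ)} ∩
      Set.Ioc 0 (0 + 2 * π)) ≤ ENNReal.ofReal (π - θ) := by
  set z : ℂ := ⟨a, b⟩
  have ha : a = ‖z‖ * cos z.arg := (Complex.norm_mul_cos_arg z).symm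
  have hb : b = ‖z‖ * sin z.arg := (Complex.norm_mul_sin_arg z).symm
  refine (measure_mono ?_).trans (volume_cos_pos_inter_cos_sub_pos_le hθπ z.arg)
  refine Set.inter_subset_inter_left _ ?_
  have h (t : ℝ) : a * cos t + b * sin t = ‖z‖ * cos (t - z.arg) := by
    rw [cos_sub]
    nth_rewrite 1 [ha, hb]
    ring
  simp only [h]
  exact fun t ht ↦ ⟨pos_of_mul_pos_right ht.1 (norm_nonneg _),
    pos_of_mul_pos_right ht.2 (norm_nonneg _)⟩

section InvariantMeasure

variable {E : Type*} [NormedAddCommGroup E] [InnerProductSpace ℝ E]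
  [MeasurableSpace E] [BorelSpace E]

/-- On a finite-dimensional inner product space there is a probability measure invariant under
all linear isometries for which linear hyperplanes are null. -/
theorem exists_isometry_invariant_probabilityMeasure [FiniteDimensional ℝ E] :
    ∃ μ : Measure E, IsProbabilityMeasure μ ∧
      (∀ R : E ≃ₗᵢ[ℝ] E, MeasurePreserving R μ μ) ∧
      ∀ p : E, p ≠ 0 → μ {g | ⟪p, g⟫_ℝ = 0} = 0 := by
  let _ : MeasureSpace E := measureSpaceOfInnerProductSpace
  have hpos : volume (Metric.ball (0 : E) 1) ≠ 0 :=
    (Metric.measure_ball_pos volume _ one_pos).ne'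
  refine ⟨(volume (Metric.ball (0 : E) 1))⁻¹ • volume.restrict (Metric.ball 0 1), ⟨?_⟩, ?_, ?_⟩
  · simp [ENNReal.inv_mul_cancel hpos measure_ball_lt_top.ne]
  · intro R
    refine MeasurePreserving.smul_measure ?_ _
    have := R.measurePreserving.restrict_preimage
      (Metric.isOpen_ball (x := (0 : E)) (ε := 1)).measurableSet
    rwa [R.preimage_ball, map_zero] at this
  · intro p hp
    have h : volume {g : E | ⟪p, g⟫_ℝ = 0} = 0 := by
      have := Measure.addHaar_submodule volume (ℝ ∙ p)ᗮ (by
        rw [Ne, Submodule.orthogonal_eq_top_iff, Submodule.span_singleton_eq_bot]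
        exact hp)
      convert this
      ext g
      simp [Submodule.mem_orthogonal_singleton_iff_inner_right]
    rw [Measure.smul_apply, nonpos_iff_eq_zero.mp ((Measure.restrict_apply_le _ _).trans h.le),
      smul_zero]

variable {μ : Measure E} [IsProbabilityMeasure μ]

/-- An open half-space with null boundary has probability at least `1 / 2`. -/
theorem half_le_measureReal_inner_pos (hμ : ∀ R : E ≃ₗᵢ[ℝ] E, MeasurePreserving R μ μ) {p : E}
    (hp : μ {g | ⟪p, g⟫_ℝ = 0} = 0) : 1 / 2 ≤ μ.real {g | 0 < ⟪p, g⟫_ℝ} := by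
  have hneg : μ.real {g | ⟪p, g⟫_ℝ < 0} = μ.real {g | 0 < ⟪p, g⟫_ℝ} := by
    rw [← (hμ (.neg ℝ)).measureReal_preimage
      (isOpen_lt continuous_const (by fun_prop)).measurableSet.nullMeasurableSet]
    simp [Set.preimage]
  have hcover : (Set.univ : Set E) ⊆
      {g | 0 < ⟪p, g⟫_ℝ} ∪ {g | ⟪p, g⟫_ℝ < 0} ∪ {g | ⟪p, g⟫_ℝ = 0} := fun g _ ↦ by
    rcases lt_trichotomy ⟪p, g⟫_ℝ 0 with h | h | h <;> simp [h]
  have h1 := measureReal_mono (μ := μ) hcover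
  have h2 := measureReal_union_le (μ := μ) ({g | 0 < ⟪p, g⟫_ℝ} ∪ {g | ⟪p, g⟫_ℝ < 0})
    {g | ⟪p, g⟫_ℝ = 0}
  have h3 := measureReal_union_le (μ := μ) {g | 0 < ⟪p, g⟫_ℝ} {g | ⟪p, g⟫_ℝ < 0}
  have h4 : μ.real {g | ⟪p, g⟫_ℝ = 0} = 0 := by simp [measureReal_def, hp]
  rw [probReal_univ] at h1
  linarith

variable [FiniteDimensional ℝ E]

/-- Two open half-spaces whose normals form an angle `θ` meet in probability at most
`(π - θ) / (2 * π)` under an isometry-invariant probability measure. -/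
theorem measureReal_inner_pos_and_inner_pos_le (hμ : ∀ R : E ≃ₗᵢ[ℝ] E, MeasurePreserving R μ μ)
    {e f : E} (he : ‖e‖ = 1) (hf : ‖f‖ = 1) (hef : ⟪e, f⟫_ℝ = 0) {θ : ℝ} (hθπ : θ ≤ π) :
    μ.real {g | 0 < ⟪e, g⟫_ℝ ∧ 0 < cos θ * ⟪e, g⟫_ℝ + sin θ * ⟪f, g⟫_ℝ} ≤ (π - θ) / (2 * π) := by
  set A : Set E := {g | 0 < ⟪e, g⟫_ℝ ∧ 0 < cos θ * ⟪e, g⟫_ℝ + sin θ * ⟪f, g⟫_ℝ} with hA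
  have hAmeas : MeasurableSet A := ((isOpen_lt continuous_const (by fun_prop)).and
      (isOpen_lt continuous_const (by fun_prop))).measurableSet
  set B : Set (ℝ × E) := {x |
    0 < ⟪e, x.2⟫_ℝ * cos x.1 + ⟪f, x.2⟫_ℝ * sin x.1 ∧
    0 < ⟪e, x.2⟫_ℝ * cos (x.1 - θ) + ⟪f, x.2⟫_ℝ * sin (x.1 - θ)} with hB
  have hBmeas : MeasurableSet B := ((isOpen_lt continuous_const (by fun_prop)).and
      (isOpen_lt continuous_const (by fun_prop))).measurableSet
  have hslice (t : ℝ) : μ (Prod.mk t ⁻¹' B) = μ A := by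
    set u : E := cos (t / 2) • e + sin (t / 2) • f with hu
    have hfe : ⟪f, e⟫_ℝ = 0 := by rw [real_inner_comm, hef]
    have hee : ⟪e, e⟫_ℝ = 1 := by rw [real_inner_self_eq_norm_sq, he, one_pow]
    have hff : ⟪f, f⟫_ℝ = 1 := by rw [real_inner_self_eq_norm_sq, hf, one_pow]
    have hu1 : ‖u‖ ^ 2 = 1 := by
      rw [← real_inner_self_eq_norm_sq, hu]
      simp only [inner_add_left, inner_add_right, real_inner_smul_left, real_inner_smul_right,
        hef, hfe, hee, hff]
      linear_combination cos_sq_add_sin_sq (t / 2)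
    have hc : cos t = 2 * cos (t / 2) ^ 2 - 1 := by rw [← cos_two_mul]; congr 1; ring
    have hs : sin t = 2 * sin (t / 2) * cos (t / 2) := by rw [← sin_two_mul]; congr 1; ring
    have hcs := cos_sq_add_sin_sq (t / 2)
    rw [← (hμ (ℝ ∙ u).reflection).measure_preimage hAmeas.nullMeasurableSet]
    congr 1
    ext g
    have h1 : ⟪e, (ℝ ∙ u).reflection g⟫_ℝ = ⟪e, g⟫_ℝ * cos t + ⟪f, g⟫_ℝ * sin t := by
      rw [Submodule.reflection_singleton_apply]
      simp only [RCLike.ofReal_real_eq_id, id_eq, hu1, div_one, inner_sub_right, two_smul,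
        inner_add_right, real_inner_smul_right]
      rw [hu]
      simp only [inner_add_left, inner_add_right, real_inner_smul_left, real_inner_smul_right,
        hef, hee, hc, hs]
      ring
    have h2 : ⟪f, (ℝ ∙ u).reflection g⟫_ℝ = ⟪e, g⟫_ℝ * sin t - ⟪f, g⟫_ℝ * cos t := by
      rw [Submodule.reflection_singleton_apply]
      simp only [RCLike.ofReal_real_eq_id, id_eq, hu1, div_one, inner_sub_right, two_smul,
        inner_add_right, real_inner_smul_right]
      rw [hu]
      simp only [inner_add_left, inner_add_right, real_inner_smul_left, real_inner_smul_right,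
        hfe, hff, hc, hs]
      linear_combination 2 * ⟪f, g⟫_ℝ * hcs
    simp only [hA, hB, Set.mem_preimage, Set.mem_ofPred_eq, h1, h2, cos_sub, sin_sub]
    ring_nf
  have key : ENNReal.ofReal (2 * π) * μ A ≤ ENNReal.ofReal (π - θ) := by
    calc
      _ = ((volume.restrict (Set.Ioc 0 (0 + 2 * π))).prod μ) B := by
        rw [Measure.prod_apply hBmeas]
        simp [hslice, mul_comm]
      _ = ∫⁻ g, volume.restrict (Set.Ioc 0 (0 + 2 * π)) ((fun t ↦ (t, g)) ⁻¹' B) ∂μ :=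
        Measure.prod_apply_symm hBmeas
      _ ≤ ∫⁻ _, ENNReal.ofReal (π - θ) ∂μ := by
        refine lintegral_mono fun g ↦ ?_
        rw [Measure.restrict_apply (measurable_prodMk_right hBmeas)]
        exact volume_linear_cos_sin_pos_le hθπ ⟪e, g⟫_ℝ ⟪f, g⟫_ℝ
      _ = _ := by simp
  have := ENNReal.toReal_mono ENNReal.ofReal_ne_top key
  rw [ENNReal.toReal_mul, ENNReal.toReal_ofReal two_pi_pos.le,
    ENNReal.toReal_ofReal (by linarith)] at this
  rw [le_div_iff₀ two_pi_pos, mul_comm]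
  exact this

/-- For `θ` between `π / 2` and `π`, `(π - θ) / (2 * π) ≤ √(1 + cos θ) / 4`. -/
theorem pi_sub_div_two_pi_le_sqrt {θ : ℝ} (hθ : π / 2 ≤ θ) (hθπ : θ ≤ π) :
    (π - θ) / (2 * π) ≤ √(1 + cos θ) / 4 := by
  have hπ := pi_pos
  obtain ⟨y, rfl⟩ : ∃ y, θ = π - 2 * y := ⟨(π - θ) / 2, by ring⟩
  have hconc := strictConcaveOn_sin_Icc.concaveOn.2
    (show (0 : ℝ) ∈ Set.Icc 0 π from ⟨le_rfl, hπ.le⟩)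
    (show π / 4 ∈ Set.Icc 0 π from ⟨by linarith, by linarith⟩)
    (show 0 ≤ 1 - 4 * y / π by rw [sub_nonneg, div_le_one hπ]; linarith)
    (show 0 ≤ 4 * y / π from div_nonneg (by linarith) hπ.le) (by ring)
  have hy : 4 * y / π * (π / 4) = y := by field_simp
  simp only [smul_eq_mul, sin_zero, mul_zero, zero_add, sin_pi_div_four, hy] at hconc
  have h2 : √2 * √2 = 2 := mul_self_sqrt zero_le_two
  have h0 : 0 ≤ y / π := div_nonneg (by linarith) hπ.le
  have hle : 4 * (y / π) ≤ √(1 + cos (π - 2 * y)) := by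
    apply le_sqrt_of_sq_le
    rw [cos_pi_sub, cos_two_mul, cos_sq']
    have h3 : 4 * (y / π) * (√2 / 2) ≤ sin y := by rwa [mul_div_assoc] at hconc
    have := pow_le_pow_left₀ (by positivity) h3 2
    nlinarith
  have : (π - (π - 2 * y)) / (2 * π) = y / π := by field_simp; ring
  linarith

/-- Two open half-spaces whose normals have equal length and cosine `c ≤ 0` meet in probability at
most `√(1 + c) / 4`. -/
theorem measureReal_inner_pos_and_inner_pos_le_sqrt
    (hμ : ∀ R : E ≃ₗᵢ[ℝ] E, MeasurePreserving R μ μ) {p q : E} {r c : ℝ} (hr : 0 < r)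
    (hp : ‖p‖ = r) (hq : ‖q‖ = r) (hpq : ⟪p, q⟫_ℝ = c * r ^ 2) (hc : c ≤ 0) :
    μ.real {g | 0 < ⟪p, g⟫_ℝ ∧ 0 < ⟪q, g⟫_ℝ} ≤ √(1 + c) / 4 := by
  have hsum : ‖p + q‖ ^ 2 = 2 * (1 + c) * r ^ 2 := by
    rw [norm_add_sq_real, hp, hq, hpq]; ring
  have hc1 : 0 ≤ 1 + c := by
    have := sq_nonneg ‖p + q‖
    rw [hsum] at this
    have := nonneg_of_mul_nonneg_left this (by positivity)
    linarith
  rcases hc1.eq_or_lt with h0 | hlt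
  · have hpq0 : p + q = 0 := by
      rw [← norm_eq_zero, ← sq_eq_zero_iff, hsum, ← h0]; ring
    have : {g | 0 < ⟪p, g⟫_ℝ ∧ 0 < ⟪q, g⟫_ℝ} = ∅ := by
      ext g
      rw [eq_neg_of_add_eq_zero_right hpq0]
      simp only [inner_neg_left, Set.mem_ofPred_eq, Set.mem_empty_iff_false, iff_false]
      intro h
      linarith [h.1, h.2]
    rw [this, measureReal_empty]
    positivity
  · set θ := arccos c with hθ
    have hcos : cos θ = c := cos_arccos (by linarith) (by linarith)
    have hsin : 0 < sin θ := by
      rw [hθ, sin_arccos]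
      exact sqrt_pos.mpr (by nlinarith)
    have hsin2 : sin θ ^ 2 = 1 - c ^ 2 := by rw [sin_sq, hcos]
    obtain ⟨e, he⟩ : ∃ e : E, e = r⁻¹ • p := ⟨_, rfl⟩
    obtain ⟨f, hf⟩ : ∃ f : E, f = (sin θ)⁻¹ • (r⁻¹ • q - c • e) := ⟨_, rfl⟩
    have hrr : r ≠ 0 := hr.ne'
    have hpp : ⟪p, p⟫_ℝ = r ^ 2 := by rw [real_inner_self_eq_norm_sq, hp]
    have hqq : ⟪q, q⟫_ℝ = r ^ 2 := by rw [real_inner_self_eq_norm_sq, hq]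
    have hqp : ⟪q, p⟫_ℝ = c * r ^ 2 := by rw [real_inner_comm, hpq]
    have he1 : ‖e‖ = 1 := by rw [he, norm_smul, hp, norm_inv, norm_of_nonneg hr.le]; field_simp
    have hef : ⟪e, f⟫_ℝ = 0 := by
      simp only [he, hf, inner_sub_right, real_inner_smul_left, real_inner_smul_right, hpp, hpq]
      field_simp
      ring
    have hf1 : ‖f‖ = 1 := by
      rw [← sq_eq_sq₀ (norm_nonneg _) zero_le_one, one_pow, ← real_inner_self_eq_norm_sq]
      simp only [he, hf, inner_sub_right, inner_sub_left, real_inner_smul_left,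
        real_inner_smul_right, hpp, hpq, hqq, hqp]
      field_simp
      rw [hsin2]
      ring
    have hmain := measureReal_inner_pos_and_inner_pos_le hμ he1 hf1 hef (arccos_le_pi c)
    have hset : {g | 0 < ⟪p, g⟫_ℝ ∧ 0 < ⟪q, g⟫_ℝ} =
        {g | 0 < ⟪e, g⟫_ℝ ∧ 0 < cos θ * ⟪e, g⟫_ℝ + sin θ * ⟪f, g⟫_ℝ} := by
      ext g
      have h1 : ⟪e, g⟫_ℝ = r⁻¹ * ⟪p, g⟫_ℝ := by rw [he, real_inner_smul_left]
      have h2 : cos θ * ⟪e, g⟫_ℝ + sin θ * ⟪f, g⟫_ℝ = r⁻¹ * ⟪q, g⟫_ℝ := by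
        rw [hf, real_inner_smul_left, inner_sub_left, real_inner_smul_left, real_inner_smul_left,
          hcos]
        field_simp
        ring
      simp only [Set.mem_ofPred_eq, h2]
      simp only [h1, mul_pos_iff_of_pos_left (inv_pos.mpr hr)]
    rw [hset]
    refine hmain.trans ?_
    have := pi_sub_div_two_pi_le_sqrt (θ := θ) ?_ (arccos_le_pi c)
    · rwa [hcos] at this
    · rw [hθ, ← arccos_zero]
      exact arccos_le_arccos hc

end InvariantMeasure

namespace SimpleGraph

variable {V : Type*} [Fintype V] [DecidableEq V] (G : SimpleGraph V) [DecidableRel G.Adj]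

/-- Deleting one endpoint of each edge inside `S` leaves an independent set; edges are counted
here as ordered pairs. -/
theorem exists_independent_subset_two_mul_card_le (S : Finset V) :
    ∃ I ⊆ S, (∀ u ∈ I, ∀ v ∈ I, ¬ G.Adj u v) ∧
      2 * S.card ≤ 2 * I.card + {x ∈ S ×ˢ S | G.Adj x.1 x.2}.card := by
  induction S using Finset.strongInduction with
  | H S ih =>
    by_cases h : ∀ u ∈ S, ∀ v ∈ S, ¬ G.Adj u v
    · exact ⟨S, subset_rfl, h, Nat.le_add_right _ _⟩
    push Not at h
    obtain ⟨u, hu, v, hv, huv⟩ := h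
    obtain ⟨I, hIS, hI, hcard⟩ := ih (S.erase u) (Finset.erase_ssubset hu)
    refine ⟨I, hIS.trans (Finset.erase_subset _ _), hI, ?_⟩
    have hdisj : Disjoint {x ∈ S.erase u ×ˢ S.erase u | G.Adj x.1 x.2} {(u, v), (v, u)} := by
      rw [Finset.disjoint_right]
      simp
    have hsub : {x ∈ S.erase u ×ˢ S.erase u | G.Adj x.1 x.2} ∪ {(u, v), (v, u)} ⊆
        {x ∈ S ×ˢ S | G.Adj x.1 x.2} := by
      intro x hx
      simp only [Finset.mem_union, Finset.mem_filter, Finset.mem_product, Finset.mem_erase,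
        Finset.mem_insert, Finset.mem_singleton] at hx ⊢
      rcases hx with hx | rfl | rfl
      · exact ⟨⟨hx.1.1.2, hx.1.2.2⟩, hx.2⟩
      · exact ⟨⟨hu, hv⟩, huv⟩
      · exact ⟨⟨hv, hu⟩, huv.symm⟩
    have hle := Finset.card_le_card hsub
    rw [Finset.card_union_of_disjoint hdisj,
      Finset.card_pair (fun h ↦ huv.ne (Prod.ext_iff.mp h).1)] at hle
    have := Finset.card_erase_add_one hu
    omega

/-- Random hyperplane rounding: if the vertices of a `d`-regular graph are assigned vectors of
equal length such that adjacent ones have cosine `c ≤ 0`, then there is a large independent set. -/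
theorem exists_independent_of_inner_eq {E : Type*} [NormedAddCommGroup E] [InnerProductSpace ℝ E]
    [FiniteDimensional ℝ E] {d : ℕ} (hreg : G.IsRegularOfDegree d) (p : V → E) {r c : ℝ}
    (hr : 0 < r) (hp : ∀ v, ‖p v‖ = r) (hadj : ∀ u v, G.Adj u v → ⟪p u, p v⟫_ℝ = c * r ^ 2)
    (hc : c ≤ 0) :
    ∃ S : Finset V, (∀ u ∈ S, ∀ v ∈ S, ¬ G.Adj u v) ∧
      (1 / 2 - d * √(1 + c) / 8) * (Fintype.card V : ℝ) ≤ (S.card : ℝ) := by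
  let _ : MeasurableSpace E := borel E
  have : BorelSpace E := ⟨rfl⟩
  obtain ⟨μ, hprob, hinv, hnull⟩ := exists_isometry_invariant_probabilityMeasure (E := E)
  let A (v : V) : Set E := {g | 0 < ⟪p v, g⟫_ℝ}
  have hA (v : V) : MeasurableSet (A v) :=
    (isOpen_lt continuous_const (by fun_prop)).measurableSet
  let f (g : E) : ℝ := ∑ v, (A v).indicator 1 g -
    1 / 2 * ∑ v, ∑ u ∈ G.neighborFinset v, (A v ∩ A u).indicator 1 g
  have hint {s : Set E} (hs : MeasurableSet s) : Integrable (s.indicator (1 : E → ℝ)) μ :=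
    (integrable_const 1).indicator hs
  have hint1 : Integrable (fun g ↦ ∑ v, (A v).indicator (1 : E → ℝ) g) μ :=
    integrable_finsetSum _ fun v _ ↦ hint (hA v)
  have hint2 (v : V) : Integrable
      (fun g ↦ ∑ u ∈ G.neighborFinset v, (A v ∩ A u).indicator (1 : E → ℝ) g) μ :=
    integrable_finsetSum _ fun u _ ↦ hint ((hA v).inter (hA u))
  have hint3 : Integrable (fun g ↦ 1 / 2 * ∑ v, ∑ u ∈ G.neighborFinset v,
      (A v ∩ A u).indicator (1 : E → ℝ) g) μ :=
    (integrable_finsetSum _ fun v _ ↦ hint2 v).const_mul _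
  have hmean : ∫ g, f g ∂μ =
      ∑ v, μ.real (A v) - 1 / 2 * ∑ v, ∑ u ∈ G.neighborFinset v, μ.real (A v ∩ A u) := by
    rw [integral_sub hint1 hint3, integral_const_mul,
      integral_finsetSum _ fun v _ ↦ hint (hA v), integral_finsetSum _ fun v _ ↦ hint2 v]
    congr 2
    · exact funext fun v ↦ integral_indicator_one (hA v)
    · refine Finset.sum_congr rfl fun v _ ↦ ?_
      rw [integral_finsetSum _ fun u _ ↦ hint ((hA v).inter (hA u))]
      exact Finset.sum_congr rfl fun u _ ↦ integral_indicator_one ((hA v).inter (hA u))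
  have hsum1 : (Fintype.card V : ℝ) * (1 / 2) ≤ ∑ v, μ.real (A v) := by
    rw [← nsmul_eq_mul]
    refine Finset.card_nsmul_le_sum _ _ _ fun v _ ↦ half_le_measureReal_inner_pos hinv ?_
    exact hnull _ (norm_pos_iff.mp (by rw [hp]; exact hr))
  have hsum2 : ∑ v, ∑ u ∈ G.neighborFinset v, μ.real (A v ∩ A u) ≤
      (Fintype.card V : ℝ) * (d * (√(1 + c) / 4)) := by
    rw [← nsmul_eq_mul]
    refine Finset.sum_le_card_nsmul _ _ _ fun v _ ↦ ?_
    rw [← hreg v, ← nsmul_eq_mul, ← G.card_neighborFinset_eq_degree]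
    refine Finset.sum_le_card_nsmul _ _ _ fun u hu ↦ ?_
    exact measureReal_inner_pos_and_inner_pos_le_sqrt hinv hr (hp v) (hp u)
      (hadj v u ((G.mem_neighborFinset v u).mp hu)) hc
  obtain ⟨g, hg⟩ := exists_integral_le (hint1.sub hint3)
  have hg : ∫ g, f g ∂μ ≤ f g := hg
  classical
  obtain ⟨I, -, hI, hcard⟩ := G.exists_independent_subset_two_mul_card_le {v | g ∈ A v}
  refine ⟨I, hI, ?_⟩
  have hcount1 : ∑ v, (A v).indicator (1 : E → ℝ) g = ({v | g ∈ A v} : Finset V).card := by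
    simp [Set.indicator_apply]
  have hcount2 : ∑ v, ∑ u ∈ G.neighborFinset v, (A v ∩ A u).indicator (1 : E → ℝ) g =
      ({x ∈ ({v | g ∈ A v} : Finset V) ×ˢ ({v | g ∈ A v} : Finset V) |
        G.Adj x.1 x.2} : Finset (V × V)).card := by
    rw [Finset.card_filter, Finset.sum_product, Finset.sum_filter]
    push_cast
    refine Finset.sum_congr rfl fun v _ ↦ ?_
    rw [neighborFinset_eq_filter, Finset.sum_filter, Finset.sum_filter]
    by_cases hv : g ∈ A v
    · simp only [hv, if_true]
      refine Finset.sum_congr rfl fun u _ ↦ ?_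
      by_cases hu : g ∈ A u <;> simp [hv, hu]
    · simp [hv]
  have hcard' : (2 : ℝ) * ({v | g ∈ A v} : Finset V).card ≤ 2 * I.card +
      ({x ∈ ({v | g ∈ A v} : Finset V) ×ˢ ({v | g ∈ A v} : Finset V) |
        G.Adj x.1 x.2} : Finset (V × V)).card := by exact_mod_cast hcard
  have hfg : f g ≤ I.card := by
    simp only [f, hcount1, hcount2]
    linarith
  linarith

/-- The orbit vectors `(x (φ v))_φ`, with `φ` ranging over the automorphisms, of an eigenvector `x`
of an arc-transitive graph have equal lengths and equal inner products along all edges. -/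
theorem exists_independent_of_arc_transitive {d : ℕ} (hd : 0 < d)
    (hreg : G.IsRegularOfDegree d)
    (harc : ∀ u₁ v₁ u₂ v₂ : V, G.Adj u₁ v₁ → G.Adj u₂ v₂ →
      ∃ φ : G ≃g G, φ u₁ = u₂ ∧ φ v₁ = v₂)
    {lam : ℝ} (hlam : lam ≤ 0) {x : V → ℝ} (hx : x ≠ 0) (heig : G.adjMatrix ℝ *ᵥ x = lam • x) :
    ∃ S : Finset V, (∀ u ∈ S, ∀ v ∈ S, ¬ G.Adj u v) ∧
      (1 / 2 - d * √(1 + lam / d) / 8) * (Fintype.card V : ℝ) ≤ (S.card : ℝ) := by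
  have : Finite (G ≃g G) := DFunLike.finite _
  let _ : Fintype (G ≃g G) := Fintype.ofFinite _
  let p (v : V) : EuclideanSpace ℝ (G ≃g G) := WithLp.toLp 2 fun φ ↦ x (φ v)
  have hinner (u v : V) : ⟪p u, p v⟫_ℝ = ∑ φ : G ≃g G, x (φ u) * x (φ v) := by
    simp [p, PiLp.inner_apply, mul_comm]
  have hinv (ψ : G ≃g G) (u v : V) : ⟪p (ψ u), p (ψ v)⟫_ℝ = ⟪p u, p v⟫_ℝ := by
    rw [hinner, hinner]
    exact Equiv.sum_comp (Equiv.mulRight ψ) fun φ : G ≃g G ↦ x (φ u) * x (φ v)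
  have hsum (φ : G ≃g G) (v : V) : ∑ u ∈ G.neighborFinset v, x (φ u) = lam * x (φ v) := by
    have h := congrFun heig (φ v)
    rw [adjMatrix_mulVec_apply, Pi.smul_apply, smul_eq_mul] at h
    rw [← h]
    exact Finset.sum_equiv φ.toEquiv (by simp [φ.map_adj_iff]) (by simp)
  have hsum_inner (v : V) : ∑ u ∈ G.neighborFinset v, ⟪p u, p v⟫_ℝ = lam * ⟪p v, p v⟫_ℝ := by
    simp only [hinner, Finset.mul_sum]
    rw [Finset.sum_comm]
    refine Finset.sum_congr rfl fun φ _ ↦ ?_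
    rw [← Finset.sum_mul, hsum, mul_assoc]
  obtain ⟨v₀, hv₀⟩ := Function.ne_iff.mp hx
  have hnbr (v : V) : ∃ u, G.Adj v u := by
    rw [← G.degree_pos_iff_exists_adj, hreg v]
    exact hd
  have hnorm (v : V) : ‖p v‖ = ‖p v₀‖ := by
    obtain ⟨u, hu⟩ := hnbr v
    obtain ⟨u₀, hu₀⟩ := hnbr v₀
    obtain ⟨ψ, rfl, -⟩ := harc v₀ u₀ v u hu₀ hu
    rw [norm_eq_sqrt_real_inner, norm_eq_sqrt_real_inner, hinv]
  have hpos : 0 < ‖p v₀‖ := by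
    rw [norm_pos_iff]
    intro h
    exact hv₀ (congrArg (fun y : EuclideanSpace ℝ (G ≃g G) ↦ y 1) h)
  refine G.exists_independent_of_inner_eq hreg p hpos hnorm (fun u v huv ↦ ?_)
    (div_nonpos_of_nonpos_of_nonneg hlam d.cast_nonneg)
  have hconst : ∑ w ∈ G.neighborFinset v, ⟪p w, p v⟫_ℝ = d * ⟪p u, p v⟫_ℝ := by
    rw [← hreg v, ← G.card_neighborFinset_eq_degree, ← nsmul_eq_mul]
    refine Finset.sum_eq_card_nsmul fun w hw ↦ ?_
    obtain ⟨ψ, rfl, hψ⟩ := harc u v w v huv ((G.mem_neighborFinset v w).mp hw).symm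
    have h := hinv ψ u v
    rwa [hψ] at h
  rw [hsum_inner, real_inner_self_eq_norm_sq, hnorm] at hconst
  have hd' : (d : ℝ) ≠ 0 := by exact_mod_cast hd.ne'
  field_simp
  linarith

end SimpleGraph

/-- A finite, `4`-regular, arc-transitive simple graph with
least adjacency-matrix eigenvalue `lam` has independence ratio at least
`1/2 - (1/4)·√(lam + 4)`. -/
theorem independence_ratio_ge_of_four_regular_arc_transitive
    {V : Type*} [Fintype V] [DecidableEq V] (G : SimpleGraph V) [DecidableRel G.Adj]
    (hreg : G.IsRegularOfDegree 4)
    (harc : ∀ u₁ v₁ u₂ v₂ : V, G.Adj u₁ v₁ → G.Adj u₂ v₂ →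
      ∃ φ : G ≃g G, φ u₁ = u₂ ∧ φ v₁ = v₂)
    (lam : ℝ)
    (hlam : IsLeast {μ : ℝ | ∃ x : V → ℝ, x ≠ 0 ∧ G.adjMatrix ℝ *ᵥ x = μ • x} lam) :
    ∃ S : Finset V, (∀ u ∈ S, ∀ v ∈ S, ¬ G.Adj u v) ∧
      (1 / 2 - (1 / 4) * Real.sqrt (lam + 4)) * (Fintype.card V : ℝ) ≤ (S.card : ℝ) := by
  rcases le_total 0 lam with h0 | h0
  · refine ⟨∅, by simp, ?_⟩
    have h2 : (2 : ℝ) ≤ √(lam + 4) := Real.le_sqrt_of_sq_le (by linarith)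
    rw [Finset.card_empty, Nat.cast_zero]
    exact mul_nonpos_of_nonpos_of_nonneg (by linarith) (Nat.cast_nonneg _)
  · obtain ⟨x, hx, heig⟩ := hlam.1
    obtain ⟨S, hS, hcard⟩ :=
      G.exists_independent_of_arc_transitive four_pos hreg harc h0 hx heig
    refine ⟨S, hS, ?_⟩
    have hsqrt : √(1 + lam / 4) = √(lam + 4) / 2 := by
      rw [show 1 + lam / 4 = (lam + 4) / 2 ^ 2 by ring, Real.sqrt_div' _ (by positivity),
        Real.sqrt_sq zero_le_two]
    convert hcard using 2
    push_cast
    rw [hsqrt]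
    ring
end

section
/- Let G be a finite, 3-regular, vertex-transitive simple graph and let λ_min be the least eigenvalue of its adjacency matrix. Then the independence ratio of G is at least q₃(λ_min) = 1/2 − (3/(4π))·arccos((1 − λ_min)/4) (equivalently, 1/8 + (3/(4π))·arcsin((1 − λ_min)/4)). -/
open Matrix

open Real in
lemma sub_le_arccos_mul_cos_sub {t y z : ℝ} (ht : 1 ≤ t) (hz : 0 ≤ z) (hzy : z ≤ y)
    (hy : y ≤ π / 2) (htz : t * cos z ≤ 1) :
    y - z ≤ arccos (t * cos y) - arccos (t * cos z) := by
  have hcy : 0 ≤ cos y := cos_nonneg_of_mem_Icc ⟨by linarith [pi_pos], hy⟩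
  have hcc : cos y ≤ cos z := cos_le_cos_of_nonneg_of_le_pi hz (by linarith [pi_pos]) hzy
  have hcz : 0 ≤ cos z := hcy.trans hcc
  have hmul : t * cos y ≤ t * cos z := by gcongr
  have hty0 : 0 ≤ t * cos y := by positivity
  have htz0 : 0 ≤ t * cos z := by positivity
  have hsy : 0 ≤ sin y := sin_nonneg_of_nonneg_of_le_pi (by linarith) (by linarith [pi_pos])
  have hsz : 0 ≤ sin z := sin_nonneg_of_nonneg_of_le_pi hz (by linarith [pi_pos])
  set Y := arccos (t * cos y) with hY
  set Z := arccos (t * cos z) with hZ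
  have hcY : cos Y = t * cos y := cos_arccos (by linarith) (by linarith)
  have hcZ : cos Z = t * cos z := cos_arccos (by linarith) (by linarith)
  have hZ0 : 0 ≤ Z := arccos_nonneg _
  have hYZ : Z ≤ Y := arccos_le_arccos hmul
  have hY2 : Y ≤ π / 2 := arccos_le_pi_div_two.2 hty0
  have hsY : 0 ≤ sin Y := sin_nonneg_of_nonneg_of_le_pi (by linarith) (by linarith [pi_pos])
  have hsZ : 0 ≤ sin Z := sin_nonneg_of_nonneg_of_le_pi hZ0 (by linarith [pi_pos])
  rcases hzy.eq_or_lt with rfl | hlt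
  · simpa using hYZ
  have hclt : cos y < cos z := cos_lt_cos_of_nonneg_of_le_pi hz (by linarith [pi_pos]) hlt
  have hsin : sin (y - z) ≤ sin (Y - Z) := by
    have e1 := sin_sq_add_cos_sq y
    have e2 := sin_sq_add_cos_sq z
    have e3 := sin_sq_add_cos_sq Y
    have e4 := sin_sq_add_cos_sq Z
    rw [hcY] at e3
    rw [hcZ] at e4
    have l1 : sin Y ≤ sin y := by
      apply abs_le_of_sq_le_sq' _ hsy |>.2
      nlinarith [sq_nonneg (cos y), mul_self_nonneg (t - 1)]
    have l2 : sin Z ≤ sin z := by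
      apply abs_le_of_sq_le_sq' _ hsz |>.2
      nlinarith [sq_nonneg (cos z), mul_self_nonneg (t - 1)]
    have hsYpos : 0 < sin Y := by
      apply sin_pos_of_pos_of_lt_pi
      · apply arccos_pos.2
        nlinarith
      · linarith [pi_pos]
    rw [sin_sub, sin_sub, hcY, hcZ]
    have hpos : 0 < cos z * sin Y + cos y * sin Z := by
      have : 0 < cos z := by linarith
      positivity
    have hden : cos z * sin Y + cos y * sin Z ≤ cos z * sin y + cos y * sin z := by gcongr
    have hx : 0 ≤ sin y * cos z - cos y * sin z := by
      rw [← sin_sub]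
      exact sin_nonneg_of_nonneg_of_le_pi (by linarith) (by linarith [pi_pos])
    have h1 : (sin y * cos z - cos y * sin z) * (cos z * sin y + cos y * sin z)
        = cos z ^ 2 - cos y ^ 2 := by
      linear_combination cos z ^ 2 * e1 - cos y ^ 2 * e2
    have h2 : (sin Y * (t * cos z) - t * cos y * sin Z) * (cos z * sin Y + cos y * sin Z)
        = t * (cos z ^ 2 - cos y ^ 2) := by
      linear_combination t * (cos z ^ 2 * e3 - cos y ^ 2 * e4)
    refine le_of_mul_le_mul_right ?_ hpos
    calc _ ≤ (sin y * cos z - cos y * sin z) * (cos z * sin y + cos y * sin z) := by gcongr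
      _ ≤ t * (cos z ^ 2 - cos y ^ 2) := by
        rw [h1]; exact le_mul_of_one_le_left (by nlinarith) ht
      _ = _ := h2.symm
  exact (strictMonoOn_sin.le_iff_le ⟨by linarith [pi_pos], by linarith⟩
    ⟨by linarith [pi_pos], by linarith⟩).1 hsin

open Real in
lemma mul_cos_half_add_le_cos_half_add {t y z : ℝ} (ht : 1 ≤ t) (hz : 0 ≤ z) (hzy : z ≤ y)
    (hy : y ≤ π / 2) (htz : t * cos z ≤ 1) :
    t * cos ((y + z) / 2) ≤ cos ((arccos (t * cos y) + arccos (t * cos z)) / 2) := by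
  have hsub := sub_le_arccos_mul_cos_sub ht hz hzy hy htz
  have hcy : 0 ≤ cos y := cos_nonneg_of_mem_Icc ⟨by linarith [pi_pos], hy⟩
  have hcc : cos y ≤ cos z := cos_le_cos_of_nonneg_of_le_pi hz (by linarith [pi_pos]) hzy
  have hty0 : 0 ≤ t * cos y := by positivity
  have hmul : t * cos y ≤ t * cos z := by gcongr
  set Y := arccos (t * cos y) with hY
  set Z := arccos (t * cos z) with hZ
  have hcY : cos Y = t * cos y := cos_arccos (by linarith) (by linarith)
  have hcZ : cos Z = t * cos z := cos_arccos (by linarith) (by linarith)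
  have hZ0 : 0 ≤ Z := arccos_nonneg _
  have hY2 : Y ≤ π / 2 := arccos_le_pi_div_two.2 hty0
  have hd : cos ((Y - Z) / 2) ≤ cos ((y - z) / 2) :=
    cos_le_cos_of_nonneg_of_le_pi (by linarith) (by linarith [pi_pos]) (by linarith)
  have hdpos : 0 < cos ((Y - Z) / 2) :=
    cos_pos_of_mem_Ioo ⟨by linarith [pi_pos], by linarith [pi_pos]⟩
  have hn : 0 ≤ cos ((y + z) / 2) := cos_nonneg_of_mem_Icc ⟨by linarith [pi_pos], by linarith⟩
  have h1 := cos_add_cos Y Z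
  have h2 := cos_add_cos y z
  refine le_of_mul_le_mul_right ?_ hdpos
  calc t * cos ((y + z) / 2) * cos ((Y - Z) / 2) ≤ t * cos ((y + z) / 2) * cos ((y - z) / 2) := by
        gcongr
    _ = _ := by rw [hcY, hcZ] at h1; linear_combination (h1 - t * h2) / 2

open Real in
lemma two_mul_arccos_mul_add_le {t c : ℝ} (ht : 1 ≤ t) (ht2 : t ≤ 2) (hc : 1 / 2 ≤ c)
    (htc : t * c ≤ 1) :
    2 * arccos (t * c) + arccos (-(t * (2 * c ^ 2 - 1))) ≤ 3 * arccos (t / 2) := by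
  set q := arccos (t * c) with hq
  set k := arccos (t / 2) with hk
  have hcq : cos q = t * c := cos_arccos (by nlinarith) htc
  have hck : cos k = t / 2 := cos_arccos (by linarith) (by linarith)
  have hqk : q ≤ k := arccos_le_arccos (by nlinarith)
  have hq0 : 0 ≤ q := arccos_nonneg _
  have hk3 : k ≤ π / 3 := by
    rw [← arccos_cos (x := π / 3) (by positivity) (by linarith [pi_pos]), cos_pi_div_three]
    exact arccos_le_arccos (by linarith)
  have key : t * (2 * c ^ 2 - 1) ≤ cos (2 * q + π - 3 * k) := by
    have e : 2 * q + π - 3 * k = (2 * q - 3 * k) + π := by ring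
    rw [e, cos_add_pi, cos_sub, cos_two_mul, cos_three_mul, sin_two_mul, sin_three_mul, hcq, hck]
    have e1 := sin_sq_add_cos_sq q
    have e2 := sin_sq_add_cos_sq k
    rw [hcq] at e1
    rw [hck] at e2
    have hf : 0 ≤ t * (t ^ 2 - 1) * (2 * c * sin k - sin q) ^ 2 := by
      have : 0 ≤ t ^ 2 - 1 := by nlinarith
      positivity
    have e3 : 3 * sin k - 4 * sin k ^ 3 = sin k * (t ^ 2 - 1) := by
      linear_combination -4 * sin k * e2
    rw [e3]
    have e1' : sin q ^ 2 = 1 - (t * c) ^ 2 := by linarith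
    have e2' : sin k ^ 2 = 1 - (t / 2) ^ 2 := by linarith
    have hf' : t * (t ^ 2 - 1) * (2 * c * sin k - sin q) ^ 2 = t * (t ^ 2 - 1) *
        (4 * c ^ 2 * (1 - (t / 2) ^ 2) - 4 * c * sin k * sin q + (1 - (t * c) ^ 2)) := by
      rw [← e1', ← e2']; ring
    rw [hf'] at hf
    linarith
  have hr := arccos_le_arccos key
  rw [arccos_cos (by linarith) (by linarith)] at hr
  rw [arccos_neg]
  linarith

open Real in
lemma arccos_mul_cos_add_le {t y z : ℝ} (ht : 1 ≤ t) (ht2 : t ≤ 2) (hz : 0 ≤ z) (hy0 : 0 ≤ y)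
    (hy : y ≤ π / 2) (hz2 : z ≤ π / 2) (hyz : y + z ≤ 2 * π / 3) (hty : t * cos y ≤ 1)
    (htz : t * cos z ≤ 1) :
    arccos (t * cos y) + arccos (t * cos z) + arccos (-(t * cos (y + z)))
      ≤ 3 * arccos (t / 2) := by
  wlog hzy : z ≤ y generalizing y z
  · have := this hy0 hz hz2 hy (by linarith) htz hty (by linarith)
    rw [add_comm z y] at this
    linarith
  have h1 := mul_cos_half_add_le_cos_half_add ht hz hzy hy htz
  have h2 := arccos_le_arccos h1
  have hp := pi_pos
  rw [arccos_cos (by linarith [arccos_nonneg (t * cos y), arccos_nonneg (t * cos z)])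
    (by linarith [arccos_le_pi (t * cos y), arccos_le_pi (t * cos z)])] at h2
  have hc : 1 / 2 ≤ cos ((y + z) / 2) := by
    rw [← cos_pi_div_three]
    exact cos_le_cos_of_nonneg_of_le_pi (by linarith) (by linarith) (by linarith)
  have h3 := two_mul_arccos_mul_add_le ht ht2 hc (h1.trans (cos_le_one _))
  rw [← cos_two_mul, mul_div_cancel₀ _ two_ne_zero] at h3
  linarith

open Real in
lemma sum_arccos_mul_cos_law_le_of_max {t a b c : ℝ} (ht : 1 ≤ t) (ht2 : t ≤ 2) (ha : 0 < a)
    (hb : 0 < b) (hc : 0 < c) (hab : b ≤ a) (hac : c ≤ a)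
    (hB : t * ((a ^ 2 + c ^ 2 - b ^ 2) / (2 * a * c)) ≤ 1)
    (hC : t * ((a ^ 2 + b ^ 2 - c ^ 2) / (2 * a * b)) ≤ 1) :
    arccos (t * ((a ^ 2 + c ^ 2 - b ^ 2) / (2 * a * c)))
      + arccos (t * ((a ^ 2 + b ^ 2 - c ^ 2) / (2 * a * b)))
      + arccos (t * ((b ^ 2 + c ^ 2 - a ^ 2) / (2 * b * c))) ≤ 3 * arccos (t / 2) := by
  set y := (a ^ 2 + c ^ 2 - b ^ 2) / (2 * a * c) with hy
  set z := (a ^ 2 + b ^ 2 - c ^ 2) / (2 * a * b) with hz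
  have hy0 : 0 ≤ y := div_nonneg (by nlinarith) (by positivity)
  have hz0 : 0 ≤ z := div_nonneg (by nlinarith) (by positivity)
  have hy1 : y ≤ 1 := by nlinarith
  have hz1 : z ≤ 1 := by nlinarith
  have cy : cos (arccos y) = y := cos_arccos (by linarith) hy1
  have cz : cos (arccos z) = z := cos_arccos (by linarith) hz1
  have hsum : cos (arccos y + arccos z) = -((b ^ 2 + c ^ 2 - a ^ 2) / (2 * b * c)) := by
    have hy2 : 0 ≤ 1 - y ^ 2 := by nlinarith
    have hz2 : 0 ≤ 1 - z ^ 2 := by nlinarith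
    have hcomb : y * z + (b ^ 2 + c ^ 2 - a ^ 2) / (2 * b * c) = (1 - y ^ 2) * (c / b) := by
      rw [hy, hz]; field_simp; ring
    rw [cos_add, cy, cz, sin_arccos, sin_arccos, ← sqrt_mul hy2]
    have : (1 - y ^ 2) * (1 - z ^ 2) = ((1 - y ^ 2) * (c / b)) ^ 2 := by
      rw [hy, hz]; field_simp; ring
    rw [this, sqrt_sq (by positivity)]
    linarith
  have hle : arccos y + arccos z ≤ 2 * π / 3 := by
    have h0 := arccos_le_pi_div_two.2 hy0
    have h1 := arccos_le_pi_div_two.2 hz0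
    have hcos : cos (2 * π / 3) ≤ cos (arccos y + arccos z) := by
      rw [hsum, show 2 * π / 3 = π - π / 3 by ring, cos_pi_sub, cos_pi_div_three, neg_le_neg_iff,
        div_le_iff₀ (by positivity)]
      rcases le_total b c with h | h <;> nlinarith
    exact (strictAntiOn_cos.le_iff_ge ⟨by positivity, by linarith [pi_pos]⟩
      ⟨by linarith [arccos_nonneg y, arccos_nonneg z], by linarith⟩).1 hcos
  have := arccos_mul_cos_add_le ht ht2 (arccos_nonneg z) (arccos_nonneg y)
    (arccos_le_pi_div_two.2 hy0) (arccos_le_pi_div_two.2 hz0) hle (by rwa [cy]) (by rwa [cz])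
  rwa [cy, cz, hsum, mul_neg, neg_neg] at this

/-- If the cosines of the angles of a triangle with side lengths `a`, `b`, `c` are all multiplied
by `t ∈ [1, 2]`, then the sum of the resulting angles is largest for the equilateral triangle. -/
lemma sum_arccos_mul_cos_law_le {t a b c : ℝ} (ht : 1 ≤ t) (ht2 : t ≤ 2) (ha : 0 < a)
    (hb : 0 < b) (hc : 0 < c)
    (hA : t * ((b ^ 2 + c ^ 2 - a ^ 2) / (2 * b * c)) ≤ 1)
    (hB : t * ((a ^ 2 + c ^ 2 - b ^ 2) / (2 * a * c)) ≤ 1)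
    (hC : t * ((a ^ 2 + b ^ 2 - c ^ 2) / (2 * a * b)) ≤ 1) :
    Real.arccos (t * ((b ^ 2 + c ^ 2 - a ^ 2) / (2 * b * c)))
      + Real.arccos (t * ((a ^ 2 + c ^ 2 - b ^ 2) / (2 * a * c)))
      + Real.arccos (t * ((a ^ 2 + b ^ 2 - c ^ 2) / (2 * a * b))) ≤ 3 * Real.arccos (t / 2) := by
  have swap (x y z : ℝ) : (x ^ 2 + y ^ 2 - z ^ 2) / (2 * x * y)
      = (y ^ 2 + x ^ 2 - z ^ 2) / (2 * y * x) := by ring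
  by_cases h1 : b ≤ a ∧ c ≤ a
  · linarith [sum_arccos_mul_cos_law_le_of_max ht ht2 ha hb hc h1.1 h1.2 hB hC]
  by_cases h2 : a ≤ b ∧ c ≤ b
  · have := sum_arccos_mul_cos_law_le_of_max ht ht2 hb ha hc h2.1 h2.2 hA (by rwa [swap b a])
    rw [swap b a] at this
    linarith
  · have h3 : a ≤ c ∧ b ≤ c := by grind
    have := sum_arccos_mul_cos_law_le_of_max ht ht2 hc ha hb h3.1 h3.2 (by rwa [swap c b])
      (by rwa [swap c a])
    rw [swap c b, swap c a] at this
    linarith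

lemma le_div_mul_of_additive_on_Icc {ψ : ℝ → ℝ} {L : ℝ} (hL : 0 < L) (h0 : ∀ θ, 0 ≤ ψ θ)
    (hadd : ∀ α β, 0 ≤ α → 0 ≤ β → α + β ≤ L → ψ (α + β) = ψ α + ψ β) {θ : ℝ} (hθ : 0 ≤ θ)
    (hθL : θ ≤ L) : ψ θ ≤ θ / L * ψ L := by
  have hzero : ψ 0 = 0 := by simpa using hadd 0 0 le_rfl le_rfl (by simpa using hL.le)
  have hmul (x : ℝ) (hx : 0 ≤ x) (k : ℕ) (hk : k * x ≤ L) : ψ (k * x) = k * ψ x := by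
    induction k with
    | zero => simp [hzero]
    | succ k ih =>
      push_cast at hk ⊢
      rw [add_mul, one_mul] at hk ⊢
      rw [hadd _ _ (by positivity) hx hk, ih (by linarith)]
      ring
  have hbound (n : ℕ) : ψ θ ≤ θ / L * ψ L + ψ L * (1 / ((n : ℝ) + 1)) := by
    have hn : (0 : ℝ) < n + 1 := by positivity
    set k := ⌈(n + 1) * (θ / L)⌉₊ with hk
    have hk1 : (n + 1) * (θ / L) ≤ k := Nat.le_ceil _
    have hk2 : (k : ℝ) < (n + 1) * (θ / L) + 1 := Nat.ceil_lt_add_one (by positivity)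
    have hkn : (k : ℝ) ≤ n + 1 := by
      have : k ≤ n + 1 := by
        apply Nat.ceil_le.2
        push_cast
        exact mul_le_of_le_one_right hn.le ((div_le_one hL).2 hθL)
      exact_mod_cast this
    have hx : (0 : ℝ) ≤ L / (n + 1) := by positivity
    have hfull := hmul (L / (n + 1)) hx (n + 1) (by push_cast; field_simp; rfl)
    have hpart := hmul (L / (n + 1)) hx k (by rw [← mul_div_assoc, div_le_iff₀ hn]; nlinarith)
    push_cast at hfull
    rw [mul_div_cancel₀ _ hn.ne'] at hfull
    have hle : θ ≤ k * (L / (n + 1)) := by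
      rw [← mul_div_assoc, le_div_iff₀ hn]
      rw [← mul_div_assoc, div_le_iff₀ hL] at hk1
      linarith
    have hmono := hadd θ (k * (L / (n + 1)) - θ) hθ (by linarith)
      (by rw [add_sub_cancel, ← mul_div_assoc, div_le_iff₀ hn]; nlinarith)
    rw [add_sub_cancel] at hmono
    have h1 := h0 (k * (L / (n + 1)) - θ)
    have h2 := h0 (L / (n + 1))
    calc ψ θ ≤ k * ψ (L / (n + 1)) := by linarith
      _ ≤ ((n + 1) * (θ / L) + 1) * ψ (L / (n + 1)) := by gcongr
      _ = _ := by rw [hfull]; field_simp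
  have hlim : Filter.Tendsto (fun n : ℕ ↦ θ / L * ψ L + ψ L * (1 / ((n : ℝ) + 1)))
      Filter.atTop (nhds (θ / L * ψ L + ψ L * 0)) :=
    (tendsto_one_div_add_atTop_nhds_zero_nat.const_mul _).const_add _
  simpa using ge_of_tendsto' hlim hbound

section RandomHyperplane

open MeasureTheory ProbabilityTheory

variable {E : Type*} [NormedAddCommGroup E] [InnerProductSpace ℝ E]

/-- The set of normal vectors of hyperplanes that strictly separate `u` from `v`. -/
def separatingNormals (u v : E) : Set E := {g | inner ℝ u g * inner ℝ v g < 0}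

lemma separatingNormals_comm (u v : E) : separatingNormals u v = separatingNormals v u := by
  simp only [separatingNormals, mul_comm]

lemma separatingNormals_smul_smul {a b : ℝ} (ha : 0 < a) (hb : 0 < b) (u v : E) :
    separatingNormals (a • u) (b • v) = separatingNormals u v := by
  ext g
  simp only [separatingNormals, Set.mem_ofPred_eq, real_inner_smul_left]
  rw [show a * inner ℝ u g * (b * inner ℝ v g) = (a * b) * (inner ℝ u g * inner ℝ v g) by ring]
  have := mul_pos ha hb
  constructor <;> intro h <;> nlinarith

/-- The point at angle `θ` of the unit circle in the plane with orthonormal basis `e₁`, `e₂`. -/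
noncomputable def circlePoint (e₁ e₂ : E) (θ : ℝ) : E := Real.cos θ • e₁ + Real.sin θ • e₂

lemma inner_circlePoint {e₁ e₂ : E} (h₁ : ‖e₁‖ = 1) (h₂ : ‖e₂‖ = 1) (h₁₂ : inner ℝ e₁ e₂ = 0)
    (α β : ℝ) : inner ℝ (circlePoint e₁ e₂ α) (circlePoint e₁ e₂ β) = Real.cos (α - β) := by
  have h₂₁ : inner ℝ e₂ e₁ = 0 := by rw [real_inner_comm, h₁₂]
  simp only [circlePoint, inner_add_left, inner_add_right, real_inner_smul_left,
    real_inner_smul_right, real_inner_self_eq_norm_sq, h₁, h₂, h₁₂, h₂₁, Real.cos_sub]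
  ring

lemma norm_circlePoint {e₁ e₂ : E} (h₁ : ‖e₁‖ = 1) (h₂ : ‖e₂‖ = 1) (h₁₂ : inner ℝ e₁ e₂ = 0)
    (α : ℝ) : ‖circlePoint e₁ e₂ α‖ = 1 := by
  have h := inner_circlePoint h₁ h₂ h₁₂ α α
  rw [real_inner_self_eq_norm_sq, sub_self, Real.cos_zero] at h
  nlinarith [norm_nonneg (circlePoint e₁ e₂ α)]

lemma reflection_circlePoint {e₁ e₂ : E} (h₁ : ‖e₁‖ = 1) (h₂ : ‖e₂‖ = 1)
    (h₁₂ : inner ℝ e₁ e₂ = 0) (δ α : ℝ) :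
    (ℝ ∙ circlePoint e₁ e₂ δ).reflection (circlePoint e₁ e₂ α)
      = circlePoint e₁ e₂ (2 * δ - α) := by
  rw [Submodule.reflection_singleton_apply, inner_circlePoint h₁ h₂ h₁₂,
    norm_circlePoint h₁ h₂ h₁₂]
  have hc : Real.cos (2 * δ - α) = 2 * Real.cos (δ - α) * Real.cos δ - Real.cos α := by
    have := Real.cos_add_cos (2 * δ - α) α
    rw [show (2 * δ - α + α) / 2 = δ by ring, show (2 * δ - α - α) / 2 = δ - α by ring] at this
    linarith
  have hs : Real.sin (2 * δ - α) = 2 * Real.cos (δ - α) * Real.sin δ - Real.sin α := by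
    have := Real.sin_add_sin (2 * δ - α) α
    rw [show (2 * δ - α + α) / 2 = δ by ring, show (2 * δ - α - α) / 2 = δ - α by ring] at this
    linarith
  simp only [circlePoint, hc, hs]
  norm_num
  module

lemma disjoint_separatingNormals_circlePoint (e₁ e₂ : E) {α β : ℝ} (hα : 0 ≤ α) (hβ : 0 ≤ β)
    (hαβ : α + β ≤ Real.pi) :
    Disjoint (separatingNormals (circlePoint e₁ e₂ 0) (circlePoint e₁ e₂ α))
      (separatingNormals (circlePoint e₁ e₂ α) (circlePoint e₁ e₂ (α + β))) := by
  rw [Set.disjoint_left]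
  intro g hxy hyz
  have hlin : Real.sin (α + β) * inner ℝ (circlePoint e₁ e₂ α) g
      = Real.sin β * inner ℝ (circlePoint e₁ e₂ 0) g
        + Real.sin α * inner ℝ (circlePoint e₁ e₂ (α + β)) g := by
    simp only [circlePoint, inner_add_left, real_inner_smul_left, Real.cos_zero, Real.sin_zero,
      Real.sin_add, Real.cos_add]
    linear_combination Real.sin β * inner ℝ e₁ g * Real.sin_sq_add_cos_sq α
  have hyx (h : α + β = 0) :
      inner ℝ (circlePoint e₁ e₂ α) g = inner ℝ (circlePoint e₁ e₂ 0) g := by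
    rw [show α = 0 by linarith]
  have hpi (h : α + β = Real.pi) :
      inner ℝ (circlePoint e₁ e₂ (α + β)) g = -inner ℝ (circlePoint e₁ e₂ 0) g := by
    simp [circlePoint, h]
  simp only [separatingNormals, Set.mem_ofPred_eq] at hxy hyz
  generalize inner ℝ (circlePoint e₁ e₂ 0) g = x at *
  generalize inner ℝ (circlePoint e₁ e₂ α) g = y at *
  generalize inner ℝ (circlePoint e₁ e₂ (α + β)) g = z at *
  rcases hαβ.eq_or_lt with hπ | hπ
  · rw [hpi hπ] at hyz
    linarith
  rcases (add_nonneg hα hβ).eq_or_lt with h0 | hpos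
  · rw [hyx h0.symm] at hxy
    exact (mul_self_nonneg x).not_gt hxy
  have hsα : 0 ≤ Real.sin α := Real.sin_nonneg_of_nonneg_of_le_pi hα (by linarith)
  have hsβ : 0 ≤ Real.sin β := Real.sin_nonneg_of_nonneg_of_le_pi hβ (by linarith)
  have hsαβ : 0 < Real.sin (α + β) := Real.sin_pos_of_pos_of_lt_pi hpos hπ
  have hy : 0 < y * y := mul_self_pos.2 (by rintro rfl; simp at hxy)
  have hsum : Real.sin (α + β) * (y * y) = Real.sin β * (x * y) + Real.sin α * (y * z) := by
    linear_combination y * hlin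
  linarith [mul_pos hsαβ hy, mul_nonpos_of_nonneg_of_nonpos hsβ hxy.le,
    mul_nonpos_of_nonneg_of_nonpos hsα hyz.le]

variable [FiniteDimensional ℝ E] [MeasurableSpace E] [BorelSpace E]

lemma measurableSet_separatingNormals (u v : E) : MeasurableSet (separatingNormals u v) :=
  measurableSet_lt (by fun_prop) (by fun_prop)

lemma ae_inner_ne_zero_stdGaussian {u : E} (hu : u ≠ 0) :
    ∀ᵐ g ∂(stdGaussian E), inner ℝ u g ≠ 0 := by
  have hmap := IsGaussian.map_eq_gaussianReal (μ := stdGaussian E) (innerSL ℝ u)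
  rw [variance_dual_stdGaussian, innerSL_apply_norm] at hmap
  have hv : (‖u‖ ^ 2).toNNReal ≠ 0 := by
    have := norm_pos_iff.2 hu
    simp only [ne_eq, Real.toNNReal_eq_zero, not_le]
    positivity
  have := nullSingletonClass_gaussianReal (μ := ∫ x, innerSL ℝ u x ∂(stdGaussian E)) hv
  have h0 : (stdGaussian E).map (innerSL ℝ u) {0} = 0 := by
    rw [hmap]; exact measure_singleton 0
  rw [Measure.map_apply (by fun_prop) (measurableSet_singleton 0)] at h0
  rw [ae_iff]
  convert h0 using 2
  ext g
  simp

lemma measurePreserving_stdGaussian (σ : E ≃ₗᵢ[ℝ] E) :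
    MeasurePreserving σ (stdGaussian E) (stdGaussian E) :=
  ⟨σ.continuous.measurable, stdGaussian_map σ⟩

lemma stdGaussian_separatingNormals_map (σ : E ≃ₗᵢ[ℝ] E) (u v : E) :
    (stdGaussian E).real (separatingNormals (σ u) (σ v))
      = (stdGaussian E).real (separatingNormals u v) := by
  rw [← (measurePreserving_stdGaussian σ).measureReal_preimage
    (measurableSet_separatingNormals _ _).nullMeasurableSet]
  congr 1
  ext g
  simp [separatingNormals]

lemma stdGaussian_separatingNormals_circlePoint_add {e₁ e₂ : E} (h₁ : ‖e₁‖ = 1) (h₂ : ‖e₂‖ = 1)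
    (h₁₂ : inner ℝ e₁ e₂ = 0) (α β γ : ℝ) :
    (stdGaussian E).real
        (separatingNormals (circlePoint e₁ e₂ (α + γ)) (circlePoint e₁ e₂ (β + γ)))
      = (stdGaussian E).real
        (separatingNormals (circlePoint e₁ e₂ α) (circlePoint e₁ e₂ β)) := by
  rw [← stdGaussian_separatingNormals_map
    (ℝ ∙ circlePoint e₁ e₂ ((α + β + γ) / 2)).reflection (circlePoint e₁ e₂ α),
    reflection_circlePoint h₁ h₂ h₁₂, reflection_circlePoint h₁ h₂ h₁₂, separatingNormals_comm]
  congr 3 <;> ring_nf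

lemma separatingNormals_circlePoint_add_ae_eq {e₁ e₂ : E} (h₁ : ‖e₁‖ = 1) (h₂ : ‖e₂‖ = 1)
    (h₁₂ : inner ℝ e₁ e₂ = 0) {α β : ℝ} (hα : 0 ≤ α) (hβ : 0 ≤ β) (hαβ : α + β ≤ Real.pi) :
    separatingNormals (circlePoint e₁ e₂ 0) (circlePoint e₁ e₂ (α + β)) =ᵐ[stdGaussian E]
      (separatingNormals (circlePoint e₁ e₂ 0) (circlePoint e₁ e₂ α) ∪
        separatingNormals (circlePoint e₁ e₂ α) (circlePoint e₁ e₂ (α + β)) : Set E) := by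
  have hne (θ : ℝ) : circlePoint e₁ e₂ θ ≠ 0 := by
    rw [← norm_ne_zero_iff, norm_circlePoint h₁ h₂ h₁₂]
    exact one_ne_zero
  filter_upwards [ae_inner_ne_zero_stdGaussian (hne 0), ae_inner_ne_zero_stdGaussian (hne α),
    ae_inner_ne_zero_stdGaussian (hne (α + β))] with g g0 gα gαβ
  have hdisj : g ∈ separatingNormals _ _ → g ∉ separatingNormals _ _ :=
    fun h ↦ Set.disjoint_left.1 (disjoint_separatingNormals_circlePoint e₁ e₂ hα hβ hαβ) h
  apply propext
  change g ∈ separatingNormals _ _ ↔ g ∈ separatingNormals _ _ ∨ g ∈ separatingNormals _ _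
  simp only [separatingNormals, Set.mem_ofPred_eq, mul_neg_iff] at hdisj ⊢
  grind

lemma stdGaussian_separatingNormals_circlePoint_le {e₁ e₂ : E} (h₁ : ‖e₁‖ = 1) (h₂ : ‖e₂‖ = 1)
    (h₁₂ : inner ℝ e₁ e₂ = 0) {θ : ℝ} (hθ : 0 ≤ θ) (hθπ : θ ≤ Real.pi) :
    (stdGaussian E).real (separatingNormals (circlePoint e₁ e₂ 0) (circlePoint e₁ e₂ θ))
      ≤ θ / Real.pi := by
  have hadd (α β : ℝ) (hα : 0 ≤ α) (hβ : 0 ≤ β) (hαβ : α + β ≤ Real.pi) :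
      (stdGaussian E).real (separatingNormals (circlePoint e₁ e₂ 0) (circlePoint e₁ e₂ (α + β)))
        = (stdGaussian E).real (separatingNormals (circlePoint e₁ e₂ 0) (circlePoint e₁ e₂ α))
          + (stdGaussian E).real
            (separatingNormals (circlePoint e₁ e₂ 0) (circlePoint e₁ e₂ β)) := by
    have hrot := stdGaussian_separatingNormals_circlePoint_add h₁ h₂ h₁₂ 0 β α
    rw [zero_add, add_comm β α] at hrot
    rw [← hrot, measureReal_congr (separatingNormals_circlePoint_add_ae_eq h₁ h₂ h₁₂ hα hβ hαβ),
      measureReal_union (disjoint_separatingNormals_circlePoint e₁ e₂ hα hβ hαβ)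
        (measurableSet_separatingNormals _ _)]
  refine (le_div_mul_of_additive_on_Icc
    (ψ := fun θ ↦ (stdGaussian E).real
      (separatingNormals (circlePoint e₁ e₂ 0) (circlePoint e₁ e₂ θ))) Real.pi_pos (fun _ ↦ measureReal_nonneg) hadd
    hθ hθπ).trans ?_
  exact mul_le_of_le_one_right (div_nonneg hθ Real.pi_pos.le) measureReal_le_one

open InnerProductGeometry in
/-- The probability that a Gaussian random hyperplane through the origin separates `u` from `v`
is at most `1 / π` times the angle between them. -/
lemma stdGaussian_separatingNormals_le {u v : E} (hu : u ≠ 0) (hv : v ≠ 0) :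
    (stdGaussian E).real (separatingNormals u v) ≤ angle u v / Real.pi := by
  have hu' := norm_pos_iff.2 hu
  have hv' := norm_pos_iff.2 hv
  rw [← separatingNormals_smul_smul (inv_pos.2 hu') (inv_pos.2 hv'),
    ← angle_smul_left_of_pos u v (inv_pos.2 hu'), ← angle_smul_right_of_pos _ v (inv_pos.2 hv')]
  have hnu : ‖‖u‖⁻¹ • u‖ = 1 := norm_smul_inv_norm hu
  have hnv : ‖‖v‖⁻¹ • v‖ = 1 := norm_smul_inv_norm hv
  generalize ‖u‖⁻¹ • u = e at *
  generalize ‖v‖⁻¹ • v = f at *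
  have hcos : Real.cos (angle e f) = inner ℝ e f := by simp [cos_angle, hnu, hnv]
  have hee : inner ℝ e e = (1 : ℝ) := by rw [real_inner_self_eq_norm_sq, hnu, one_pow]
  have hff : inner ℝ f f = (1 : ℝ) := by rw [real_inner_self_eq_norm_sq, hnv, one_pow]
  set w := f - (inner ℝ e f : ℝ) • e with hw
  have hew : inner ℝ e w = (0 : ℝ) := by
    rw [hw, inner_sub_right, real_inner_smul_right, hee, mul_one, sub_self]
  have hww : ‖w‖ = Real.sin (angle e f) := by
    rw [← sq_eq_sq₀ (norm_nonneg _) (sin_angle_nonneg _ _), ← real_inner_self_eq_norm_sq,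
      Real.sin_sq, hcos]
    nth_rewrite 1 [hw]
    rw [inner_sub_left, real_inner_smul_left, hew, hw, inner_sub_right, real_inner_smul_right,
      hff, real_inner_comm]
    ring
  have hfw : f = Real.cos (angle e f) • e + w := by rw [hcos, hw]; abel
  by_cases hw0 : w = 0
  · rw [hw0, norm_zero] at hww
    rcases Real.sin_eq_zero_iff_cos_eq.1 hww.symm with hc | hc
    · rw [hc, one_smul, hw0, add_zero] at hfw
      subst hfw
      have : separatingNormals f f = ∅ := by
        ext g
        simp [separatingNormals, mul_self_nonneg]
      rw [this, measureReal_empty]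
      exact div_nonneg (angle_nonneg _ _) Real.pi_pos.le
    · have hπ : angle e f = Real.pi := by
        rw [← Real.arccos_cos (angle_nonneg e f) (angle_le_pi e f), hc, Real.arccos_neg_one]
      rw [hπ, div_self Real.pi_pos.ne']
      exact measureReal_le_one
  · have hnw : ‖‖w‖⁻¹ • w‖ = 1 := norm_smul_inv_norm hw0
    have h := stdGaussian_separatingNormals_circlePoint_le hnu hnw
      (by simp [real_inner_smul_right, hew]) (angle_nonneg e f) (angle_le_pi e f)
    have he0 : circlePoint e ((‖w‖⁻¹ : ℝ) • w) 0 = e := by simp [circlePoint]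
    have hef : circlePoint e ((‖w‖⁻¹ : ℝ) • w) (angle e f) = f := by
      rw [circlePoint, ← hww, smul_smul, mul_inv_cancel₀ (norm_ne_zero_iff.2 hw0), one_smul,
        ← hfw]
    rwa [he0, hef] at h

open InnerProductGeometry in
/-- A lower bound for the Gaussian measure of a trihedral cone. -/
lemma le_stdGaussian_forall_inner_pos {u v w : E} (hu : u ≠ 0) (hv : v ≠ 0) (hw : w ≠ 0) :
    1 / 2 - (angle u v + angle u w + angle v w) / (4 * Real.pi)
      ≤ (stdGaussian E).real {g | 0 < inner ℝ u g ∧ 0 < inner ℝ v g ∧ 0 < inner ℝ w g} := by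
  set μ := stdGaussian E
  set P : Set E := {g | 0 < inner ℝ u g ∧ 0 < inner ℝ v g ∧ 0 < inner ℝ w g} with hP
  set N : Set E := {g | inner ℝ u g < 0 ∧ inner ℝ v g < 0 ∧ inner ℝ w g < 0} with hN
  have hpos (x : E) : MeasurableSet {g : E | 0 < inner ℝ x g} :=
    measurableSet_lt (by fun_prop) (by fun_prop)
  have hneg (x : E) : MeasurableSet {g : E | inner ℝ x g < 0} :=
    measurableSet_lt (by fun_prop) (by fun_prop)
  have hPm : MeasurableSet P := (hpos u).inter ((hpos v).inter (hpos w))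
  have hNm : MeasurableSet N := (hneg u).inter ((hneg v).inter (hneg w))
  have hNP : μ.real N = μ.real P := by
    rw [← (measurePreserving_stdGaussian (LinearIsometryEquiv.neg ℝ)).measureReal_preimage
      hPm.nullMeasurableSet]
    congr 1
    ext g
    simp [hP, hN]
  have hind {s : Set E} (hs : MeasurableSet s) : Integrable (s.indicator (1 : E → ℝ)) μ :=
    (integrable_const (1 : ℝ)).indicator hs
  have huv := measurableSet_separatingNormals u v
  have huw := measurableSet_separatingNormals u w
  have hvw := measurableSet_separatingNormals v w
  have hmono : ∫ g, (2 : ℝ) ∂μ ≤ ∫ g, (2 * (P.indicator 1 g + N.indicator 1 g)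
      + ((separatingNormals u v).indicator 1 g + (separatingNormals u w).indicator 1 g
        + (separatingNormals v w).indicator 1 g)) ∂μ := by
    apply integral_mono_ae (integrable_const _)
    · exact (((hind hPm).add (hind hNm)).const_mul 2).add
        (((hind huv).add (hind huw)).add (hind hvw))
    filter_upwards [ae_inner_ne_zero_stdGaussian hu, ae_inner_ne_zero_stdGaussian hv,
      ae_inner_ne_zero_stdGaussian hw] with g gu gv gw
    simp only [Set.indicator_apply, hP, hN, separatingNormals, Set.mem_ofPred_eq, Pi.one_apply,
      mul_neg_iff]
    rcases lt_or_gt_of_ne gu with a | a <;> rcases lt_or_gt_of_ne gv with b | b <;>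
      rcases lt_or_gt_of_ne gw with c | c <;> norm_num [a, b, c, a.not_gt, b.not_gt, c.not_gt]
  have hPN : Integrable (fun g ↦ 2 * (P.indicator (1 : E → ℝ) g + N.indicator 1 g)) μ :=
    ((hind hPm).add (hind hNm)).const_mul 2
  have hS : Integrable (fun g ↦ (separatingNormals u v).indicator (1 : E → ℝ) g
      + (separatingNormals u w).indicator 1 g) μ := (hind huv).add (hind huw)
  have hT : Integrable (fun g ↦ (separatingNormals u v).indicator (1 : E → ℝ) g
      + (separatingNormals u w).indicator 1 g + (separatingNormals v w).indicator 1 g) μ :=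
    hS.add (hind hvw)
  rw [integral_add hPN hT, integral_const_mul,
    integral_add (hind hPm) (hind hNm), integral_add hS (hind hvw),
    integral_add (hind huv) (hind huw), integral_indicator_one hPm, integral_indicator_one hNm,
    integral_indicator_one huv, integral_indicator_one huw, integral_indicator_one hvw,
    integral_const, probReal_univ, one_smul, hNP] at hmono
  have h1 := stdGaussian_separatingNormals_le hu hv
  have h2 := stdGaussian_separatingNormals_le hu hw
  have h3 := stdGaussian_separatingNormals_le hv hw
  have h4 : (angle u v + angle u w + angle v w) / (4 * Real.pi)
      = (angle u v / Real.pi + angle u w / Real.pi + angle v w / Real.pi) / 4 := by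
    field_simp
  rw [h4]
  linarith

end RandomHyperplane

section NeighborVectors

open InnerProductGeometry

variable {E : Type*} [NormedAddCommGroup E] [InnerProductSpace ℝ E] {x y₁ y₂ y₃ : E} {lam : ℝ}

lemma inner_sub_sub_of_add_eq_smul (hx : ‖x‖ = 1) (h₁ : ‖y₁‖ = 1) (h₂ : ‖y₂‖ = 1)
    (h₃ : ‖y₃‖ = 1) (hsum : y₁ + y₂ + y₃ = lam • x) :
    inner ℝ (x - y₁) (x - y₂)
      = (1 - lam) / 4 * (‖x - y₁‖ ^ 2 + ‖x - y₂‖ ^ 2 - ‖x - y₃‖ ^ 2) := by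
  have hsx := congrArg (inner ℝ x) hsum
  have hs₁ := congrArg (inner ℝ y₁) hsum
  have hs₂ := congrArg (inner ℝ y₂) hsum
  have hs₃ := congrArg (inner ℝ y₃) hsum
  simp only [inner_add_right, real_inner_smul_right, real_inner_self_eq_norm_sq, hx, h₁, h₂, h₃]
    at hsx hs₁ hs₂ hs₃
  simp only [norm_sub_sq_real, inner_sub_left, inner_sub_right, real_inner_self_eq_norm_sq, hx,
    h₁, h₂, h₃]
  rw [real_inner_comm y₁ y₂, real_inner_comm x y₂] at hs₂
  rw [real_inner_comm y₁ y₃, real_inner_comm y₂ y₃, real_inner_comm x y₃] at hs₃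
  rw [real_inner_comm x y₁] at hs₁ ⊢
  linarith

lemma sub_ne_zero_of_add_eq_smul (hx : ‖x‖ = 1) (h₁ : ‖y₁‖ = 1) (h₂ : ‖y₂‖ = 1)
    (h₃ : ‖y₃‖ = 1) (hsum : y₁ + y₂ + y₃ = lam • x) (hlam : lam < -1) : x - y₁ ≠ 0 := by
  intro h0
  have h12 := inner_sub_sub_of_add_eq_smul hx h₁ h₂ h₃ hsum
  have h23 := inner_sub_sub_of_add_eq_smul hx h₂ h₃ h₁ (by rw [← hsum]; abel)
  rw [h0, inner_zero_left, norm_zero] at h12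
  rw [h0, norm_zero] at h23
  have heq : ‖x - y₂‖ ^ 2 = ‖x - y₃‖ ^ 2 := by
    rcases mul_eq_zero.1 h12.symm with h | h <;> linarith
  have heq' : ‖x - y₂‖ = ‖x - y₃‖ := (sq_eq_sq₀ (norm_nonneg _) (norm_nonneg _)).1 heq
  have hcs := real_inner_le_norm (x - y₂) (x - y₃)
  rw [h23, ← heq'] at hcs
  have hy₂ : x - y₂ = 0 := by
    rw [← norm_eq_zero]
    by_contra hne
    have : 0 < ‖x - y₂‖ * ‖x - y₂‖ := mul_self_pos.2 hne
    nlinarith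
  have hy₃ : x - y₃ = 0 := by rw [← norm_eq_zero, ← heq', hy₂, norm_zero]
  rw [← sub_eq_zero.1 h0, ← sub_eq_zero.1 hy₂, ← sub_eq_zero.1 hy₃] at hsum
  have h := congrArg (inner ℝ x) hsum
  simp only [inner_add_right, real_inner_smul_right, real_inner_self_eq_norm_sq, hx] at h
  linarith

lemma angle_add_angle_add_angle_le_of_add_eq_smul (hx : ‖x‖ = 1) (h₁ : ‖y₁‖ = 1)
    (h₂ : ‖y₂‖ = 1) (h₃ : ‖y₃‖ = 1) (hsum : y₁ + y₂ + y₃ = lam • x) (hlam : lam < -1) :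
    angle (x - y₁) (x - y₂) + angle (x - y₁) (x - y₃) + angle (x - y₂) (x - y₃)
      ≤ 3 * Real.arccos ((1 - lam) / 4) := by
  have hsum' : y₁ + y₃ + y₂ = lam • x := by rw [← hsum]; abel
  have hsum'' : y₂ + y₃ + y₁ = lam • x := by rw [← hsum]; abel
  have i12 := inner_sub_sub_of_add_eq_smul hx h₁ h₂ h₃ hsum
  have i13 := inner_sub_sub_of_add_eq_smul hx h₁ h₃ h₂ hsum'
  have i23 := inner_sub_sub_of_add_eq_smul hx h₂ h₃ h₁ hsum''
  have n1 := norm_pos_iff.2 (sub_ne_zero_of_add_eq_smul hx h₁ h₂ h₃ hsum hlam)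
  have n2 := norm_pos_iff.2 (sub_ne_zero_of_add_eq_smul hx h₂ h₃ h₁ hsum'' hlam)
  have n3 := norm_pos_iff.2 (sub_ne_zero_of_add_eq_smul hx h₃ h₁ h₂
    (by rw [← hsum]; abel) hlam)
  have a12 := (abs_le.1 (abs_real_inner_div_norm_mul_norm_le_one (x - y₁) (x - y₂))).2
  have a13 := (abs_le.1 (abs_real_inner_div_norm_mul_norm_le_one (x - y₁) (x - y₃))).2
  have a23 := (abs_le.1 (abs_real_inner_div_norm_mul_norm_le_one (x - y₂) (x - y₃))).2
  have hlam3 : -3 ≤ lam := by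
    have h := congrArg (inner ℝ x) hsum
    have b1 := (abs_le.1 (abs_real_inner_le_norm x y₁)).1
    have b2 := (abs_le.1 (abs_real_inner_le_norm x y₂)).1
    have b3 := (abs_le.1 (abs_real_inner_le_norm x y₃)).1
    simp only [inner_add_right, real_inner_smul_right, real_inner_self_eq_norm_sq, hx, h₁, h₂,
      h₃] at h b1 b2 b3
    linarith
  unfold angle
  rw [i12] at a12 ⊢
  rw [i13] at a13 ⊢
  rw [i23] at a23 ⊢
  generalize ‖x - y₁‖ = a at *
  generalize ‖x - y₂‖ = b at *
  generalize ‖x - y₃‖ = c at *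
  have e (p q r : ℝ) : (1 - lam) / 4 * (p ^ 2 + q ^ 2 - r ^ 2) / (p * q)
      = (1 - lam) / 2 * ((p ^ 2 + q ^ 2 - r ^ 2) / (2 * p * q)) := by ring
  rw [e] at a12 a13 a23
  rw [e, e, e, show (1 - lam) / 4 = (1 - lam) / 2 / 2 by ring]
  linarith [sum_arccos_mul_cos_law_le (t := (1 - lam) / 2) (by linarith) (by linarith) n1 n2 n3
    a23 a13 a12]

end NeighborVectors

section CubicGraph

open MeasureTheory ProbabilityTheory

variable {V : Type*} [Fintype V] (G : SimpleGraph V) [DecidableRel G.Adj]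

/-- A maximum independent set of a graph of maximum degree at most `d` contains at least a
`1 / (d + 1)` fraction of the vertices. -/
lemma exists_independent_card_le_mul {d : ℕ} (hdeg : ∀ v, G.degree v ≤ d) :
    ∃ S : Finset V, (∀ u ∈ S, ∀ v ∈ S, ¬ G.Adj u v) ∧ Fintype.card V ≤ (d + 1) * S.card := by
  classical
  obtain ⟨S, hS⟩ := (Set.toFinite {S : Finset V | ∀ u ∈ S, ∀ v ∈ S, ¬ G.Adj u v}).exists_maximal
    ⟨∅, by simp⟩
  refine ⟨S, hS.prop, ?_⟩
  have hcover : (Finset.univ : Finset V) ⊆ S.biUnion fun v ↦ insert v (G.neighborFinset v) := by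
    intro v _
    by_contra hv
    simp only [Finset.mem_biUnion, Finset.mem_insert, SimpleGraph.mem_neighborFinset, not_exists,
      not_and, not_or] at hv
    have hins : ∀ a ∈ insert v S, ∀ b ∈ insert v S, ¬ G.Adj a b := by
      intro a ha b hb hab
      rcases Finset.mem_insert.1 ha with rfl | haS <;>
        rcases Finset.mem_insert.1 hb with rfl | hbS
      · exact G.irrefl hab
      · exact (hv b hbS).2 hab.symm
      · exact (hv a haS).2 hab
      · exact hS.prop a haS b hbS hab
    have hvS := hS.le_of_ge hins (Finset.subset_insert v S) (Finset.mem_insert_self v S)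
    exact (hv v hvS).1 rfl
  calc Fintype.card V ≤ (S.biUnion fun v ↦ insert v (G.neighborFinset v)).card :=
        Finset.card_le_card hcover
    _ ≤ S.card * (d + 1) := by
        apply Finset.card_biUnion_le_card_mul
        intro v _
        exact (Finset.card_insert_le _ _).trans (Nat.succ_le_succ (hdeg v))
    _ = _ := mul_comm _ _

/-- A real eigenvalue of a vertex-transitive graph is realized by a system of unit vectors indexed
by the vertices. -/
lemma exists_unit_eigenvectors (htrans : ∀ u v : V, ∃ φ : G ≃g G, φ u = v) [Fintype (G ≃g G)]
    {lam : ℝ} {f : V → ℝ} (hf : f ≠ 0) (hlam : G.adjMatrix ℝ *ᵥ f = lam • f) :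
    ∃ x : V → EuclideanSpace ℝ (G ≃g G),
      (∀ v, ‖x v‖ = 1) ∧ ∀ v, ∑ w ∈ G.neighborFinset v, x w = lam • x v := by
  obtain ⟨v₀, hv₀⟩ := Function.ne_iff.1 hf
  set y : V → EuclideanSpace ℝ (G ≃g G) := fun v ↦ WithLp.toLp 2 fun φ ↦ f (φ v) with hy
  have hnorm (v : V) : ‖y v‖ = ‖y v₀‖ := by
    obtain ⟨ψ, rfl⟩ := htrans v₀ v
    rw [EuclideanSpace.norm_eq, EuclideanSpace.norm_eq]
    congr 1
    exact Fintype.sum_equiv (Equiv.mulRight ψ) _ _ fun φ ↦ rfl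
  have hne : ‖y v₀‖ ≠ 0 := by
    rw [norm_ne_zero_iff]
    intro h
    exact hv₀ (congrArg (fun z : EuclideanSpace ℝ (G ≃g G) ↦ z 1) h)
  have hsum (v : V) : ∑ w ∈ G.neighborFinset v, y w = lam • y v := by
    ext φ
    have h := congrFun hlam (φ v)
    rw [SimpleGraph.adjMatrix_mulVec_apply] at h
    have hmap : G.neighborFinset (φ v) = (G.neighborFinset v).map φ.toEquiv.toEmbedding := by
      ext w
      simp only [SimpleGraph.mem_neighborFinset, Finset.mem_map_equiv]
      have hadj := φ.map_adj_iff (v := v) (w := φ.symm w)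
      rwa [φ.apply_symm_apply] at hadj
    rw [hmap, Finset.sum_map] at h
    simpa [hy] using h
  refine ⟨fun v ↦ ‖y v₀‖⁻¹ • y v, fun v ↦ ?_, fun v ↦ ?_⟩
  · rw [norm_smul, norm_inv, norm_norm, hnorm v, inv_mul_cancel₀ hne]
  · rw [← Finset.smul_sum, hsum, smul_comm]

/-- Vertices at which a Gaussian random linear functional of the given vectors has a strict local
maximum form an independent set. -/
lemma exists_independent_of_unit_eigenvectors {E : Type*} [NormedAddCommGroup E]
    [InnerProductSpace ℝ E] [FiniteDimensional ℝ E] [MeasurableSpace E] [BorelSpace E]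
    (hreg : G.IsRegularOfDegree 3) {lam : ℝ} (hlam : lam < -1) {x : V → E} (hx : ∀ v, ‖x v‖ = 1)
    (hsum : ∀ v, ∑ w ∈ G.neighborFinset v, x w = lam • x v) :
    ∃ S : Finset V, (∀ u ∈ S, ∀ v ∈ S, ¬ G.Adj u v) ∧
      (1 / 2 - (3 / (4 * Real.pi)) * Real.arccos ((1 - lam) / 4)) * (Fintype.card V : ℝ)
        ≤ (S.card : ℝ) := by
  classical
  set q := 1 / 2 - (3 / (4 * Real.pi)) * Real.arccos ((1 - lam) / 4) with hq
  let D (v : V) : Set E := {g | ∀ w ∈ G.neighborFinset v, 0 < inner ℝ (x v - x w) g}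
  have hDm (v : V) : MeasurableSet (D v) := by
    have : D v = ⋂ w ∈ G.neighborFinset v, {g | 0 < inner ℝ (x v - x w) g} := by
      ext g
      simp [D]
    rw [this]
    exact Finset.measurableSet_biInter _ fun w _ ↦ measurableSet_lt (by fun_prop) (by fun_prop)
  have hD (v : V) : q ≤ (stdGaussian E).real (D v) := by
    obtain ⟨a, b, c, hab, hac, hbc, hN⟩ := Finset.card_eq_three.1 (hreg v)
    have hs := hsum v
    rw [hN, Finset.sum_insert (by simp [hab, hac]), Finset.sum_pair hbc, ← add_assoc] at hs
    have hcone := le_stdGaussian_forall_inner_pos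
      (sub_ne_zero_of_add_eq_smul (hx v) (hx a) (hx b) (hx c) hs hlam)
      (sub_ne_zero_of_add_eq_smul (hx v) (hx b) (hx c) (hx a) (by rw [← hs]; abel) hlam)
      (sub_ne_zero_of_add_eq_smul (hx v) (hx c) (hx a) (hx b) (by rw [← hs]; abel) hlam)
    have hangle := angle_add_angle_add_angle_le_of_add_eq_smul (hx v) (hx a) (hx b) (hx c) hs hlam
    have hDv : D v = {g | 0 < inner ℝ (x v - x a) g ∧ 0 < inner ℝ (x v - x b) g ∧
        0 < inner ℝ (x v - x c) g} := by
      ext g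
      simp only [D, hN, Finset.forall_mem_insert, Finset.mem_singleton, forall_eq]
    rw [hDv]
    refine le_trans ?_ hcone
    rw [hq, sub_le_sub_iff_left, div_mul_eq_mul_div]
    gcongr
  have hind (v : V) : Integrable ((D v).indicator (1 : E → ℝ)) (stdGaussian E) :=
    (integrable_const (1 : ℝ)).indicator (hDm v)
  obtain ⟨g, hg⟩ := exists_integral_le (μ := stdGaussian E)
    (integrable_finsetSum Finset.univ fun v _ ↦ hind v)
  rw [integral_finsetSum _ fun v _ ↦ hind v] at hg
  simp only [integral_indicator_one (hDm _)] at hg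
  refine ⟨Finset.univ.filter fun v ↦ g ∈ D v, ?_, ?_⟩
  · intro u hu v hv huv
    have h1 := (Finset.mem_filter.1 hu).2 v ((G.mem_neighborFinset u v).2 huv)
    have h2 := (Finset.mem_filter.1 hv).2 u ((G.mem_neighborFinset v u).2 huv.symm)
    rw [inner_sub_left] at h1 h2
    linarith
  · calc q * (Fintype.card V : ℝ) = ∑ _v : V, q := by simp [mul_comm]
      _ ≤ ∑ v, (stdGaussian E).real (D v) := Finset.sum_le_sum fun v _ ↦ hD v
      _ ≤ _ := hg
      _ = _ := by
        simp only [Set.indicator_apply, Pi.one_apply]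
        rw [Finset.sum_boole]

end CubicGraph

/-- A finite, `3`-regular, vertex-transitive simple graph with
least adjacency-matrix eigenvalue `lam` has independence ratio at least
`q₃(lam) = 1/2 - (3/(4π))·arccos((1 - lam)/4)`. -/
theorem independence_ratio_ge_of_cubic_vertex_transitive
    {V : Type*} [Fintype V] [DecidableEq V] (G : SimpleGraph V) [DecidableRel G.Adj]
    (hreg : G.IsRegularOfDegree 3)
    (htrans : ∀ u v : V, ∃ φ : G ≃g G, φ u = v)
    (lam : ℝ)
    (hlam : IsLeast {μ : ℝ | ∃ x : V → ℝ, x ≠ 0 ∧ G.adjMatrix ℝ *ᵥ x = μ • x} lam) :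
    ∃ S : Finset V, (∀ u ∈ S, ∀ v ∈ S, ¬ G.Adj u v) ∧
      (1 / 2 - (3 / (4 * Real.pi)) * Real.arccos ((1 - lam) / 4)) * (Fintype.card V : ℝ)
        ≤ (S.card : ℝ) := by
  have hpi := Real.pi_pos
  obtain ⟨f, hf, hAf⟩ := hlam.1
  rcases lt_or_ge lam (-1) with h | h
  · have := Finite.of_injective (fun φ : G ≃g G ↦ (φ : V → V)) DFunLike.coe_injective
    have := Fintype.ofFinite (G ≃g G)
    obtain ⟨x, hx, hsum⟩ := exists_unit_eigenvectors G htrans hf hAf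
    exact exists_independent_of_unit_eigenvectors G hreg h hx hsum
  · obtain ⟨S, hS, hcard⟩ := exists_independent_card_le_mul G fun v ↦ (hreg v).le
    refine ⟨S, hS, ?_⟩
    have hcard' : (Fintype.card V : ℝ) ≤ 4 * S.card := by exact_mod_cast hcard
    have harc : Real.pi / 3 ≤ Real.arccos ((1 - lam) / 4) := by
      rw [← Real.arccos_cos (x := Real.pi / 3) (by positivity) (by linarith), Real.cos_pi_div_three]
      exact Real.arccos_le_arccos (by linarith)
    have hq : 1 / 2 - (3 / (4 * Real.pi)) * Real.arccos ((1 - lam) / 4) ≤ 1 / 4 := by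
      have : 3 / (4 * Real.pi) * (Real.pi / 3) = 1 / 4 := by field_simp
      have : 3 / (4 * Real.pi) * (Real.pi / 3)
          ≤ 3 / (4 * Real.pi) * Real.arccos ((1 - lam) / 4) := by gcongr
      linarith
    calc _ ≤ 1 / 4 * (Fintype.card V : ℝ) := by gcongr
      _ ≤ _ := by linarith
end

section
/- Let G be a finite, d-regular (d ≥ 3), vertex-transitive, cherry-transitive simple graph, let λ be an eigenvalue of its adjacency matrix A, and let P be the matrix of the orthogonal projection of ℝ^V onto the eigenspace {x : A x = λ x}. Then for every vertex v and every pair of distinct neighbors u, w of v, the entry P(u,w) equals ((λ² − d)/(d(d−1)))·P(v,v). -/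
open Matrix

/-- The adjacency matrix is invariant under graph automorphisms. -/
theorem adjMatrix_submatrix_iso {V R : Type*} [Zero R] [One R] (G : SimpleGraph V)
    [DecidableRel G.Adj] (φ : G ≃g G) :
    (G.adjMatrix R).submatrix φ φ = G.adjMatrix R := by
  ext i j
  simp [SimpleGraph.adjMatrix_apply, φ.map_adj_iff]

/-- A symmetric matrix with range in an eigenspace of the adjacency matrix that fixes this
eigenspace is invariant under graph automorphisms. -/
theorem eigenprojection_submatrix_iso {V : Type*} [Fintype V] [DecidableEq V]
    (G : SimpleGraph V) [DecidableRel G.Adj] {lam : ℝ} {P : Matrix V V ℝ}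
    (hsymm : P.IsSymm) (hAP : G.adjMatrix ℝ * P = lam • P)
    (hfix : ∀ x : V → ℝ, G.adjMatrix ℝ *ᵥ x = lam • x → P *ᵥ x = x) (φ : G ≃g G) :
    P.submatrix φ φ = P := by
  have key (ψ : G ≃g G) : P * P.submatrix ψ ψ = P.submatrix ψ ψ := by
    have hψ : G.adjMatrix ℝ * P.submatrix ψ ψ = lam • P.submatrix ψ ψ := by
      have h := congrArg (fun M : Matrix V V ℝ => M.submatrix ψ ψ) hAP
      rw [← Matrix.submatrix_mul_equiv _ _ ψ ψ.toEquiv ψ] at h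
      change (G.adjMatrix ℝ).submatrix ψ ψ * P.submatrix ψ ψ = _ at h
      rwa [adjMatrix_submatrix_iso] at h
    ext i j
    exact congrFun (hfix (fun k => P.submatrix ψ ψ k j)
      (funext fun k => congrFun (congrFun hψ k) j)) i
  have hleft : P.submatrix φ φ * P = P := by
    have h := congrArg (fun M : Matrix V V ℝ => M.submatrix φ φ) (key φ.symm)
    rw [← Matrix.submatrix_mul_equiv _ _ φ φ.toEquiv φ] at h
    change P.submatrix φ φ * (P.submatrix φ.symm φ.symm).submatrix φ φ = _ at h
    have hinv : (P.submatrix φ.symm φ.symm).submatrix φ φ = P := by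
      ext i j
      simp
    rwa [hinv] at h
  have hright := congrArg Matrix.transpose (key φ)
  rw [Matrix.transpose_mul, (hsymm.submatrix φ).eq, hsymm.eq, hleft] at hright
  exact hright.symm

/-- Let `G` be a finite, `d`-regular (`d ≥ 3`), vertex-transitive,
cherry-transitive simple graph, `lam` an eigenvalue of its adjacency matrix `A`, and `P`
the matrix of the orthogonal projection of `ℝ^V` onto the eigenspace `{x : A x = lam x}`
(characterized as the symmetric idempotent matrix acting as the identity on the
eigenspace and mapping everything into it). Then for every vertex `v` and distinct
neighbors `u, w` of `v` one has `P u w = ((lam² − d)/(d(d−1))) · P v v`. -/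
theorem cherry_transitive_projection_entry
    {V : Type*} [Fintype V] [DecidableEq V] (G : SimpleGraph V) [DecidableRel G.Adj]
    (d : ℕ) (hd : 3 ≤ d) (hreg : G.IsRegularOfDegree d)
    (htrans : ∀ u v : V, ∃ φ : G ≃g G, φ u = v)
    (hcherry : ∀ v u w v' u' w' : V,
      G.Adj v u → G.Adj v w → u ≠ w → G.Adj v' u' → G.Adj v' w' → u' ≠ w' →
      ∃ φ : G ≃g G, φ v = v' ∧ ((φ u = u' ∧ φ w = w') ∨ (φ u = w' ∧ φ w = u')))
    (lam : ℝ) (hlam : ∃ x : V → ℝ, x ≠ 0 ∧ G.adjMatrix ℝ *ᵥ x = lam • x)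
    (P : Matrix V V ℝ)
    (hPsymm : P.IsSymm) (hPidem : P * P = P)
    (hPrange : ∀ x : V → ℝ, G.adjMatrix ℝ *ᵥ (P *ᵥ x) = lam • (P *ᵥ x))
    (hPfix : ∀ x : V → ℝ, G.adjMatrix ℝ *ᵥ x = lam • x → P *ᵥ x = x) :
    ∀ v u w : V, G.Adj v u → G.Adj v w → u ≠ w →
      P u w = ((lam ^ 2 - d) / (d * ((d : ℝ) - 1))) * P v v := by
  intro v u w hu hw huw
  have hAP : G.adjMatrix ℝ * P = lam • P := by
    ext i j
    have h := hPrange (Pi.single j 1)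
    rw [Matrix.mulVec_single_one] at h
    exact congrFun h i
  have hPA : P * G.adjMatrix ℝ = lam • P := by
    have h := congrArg Matrix.transpose hAP
    rwa [Matrix.transpose_mul, Matrix.transpose_smul, hPsymm.eq,
      SimpleGraph.transpose_adjMatrix] at h
  have hinv (φ : G ≃g G) (i j : V) : P (φ i) (φ j) = P i j :=
    congrFun (congrFun (eigenprojection_submatrix_iso G hPsymm hAP hPfix φ) i) j
  have hdiag (i : V) : P i i = P v v := by
    obtain ⟨φ, rfl⟩ := htrans v i
    exact hinv φ v v
  have hoff (a b : V) (ha : G.Adj v a) (hb : G.Adj v b) (hab : a ≠ b) : P a b = P u w := by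
    obtain ⟨φ, -, ⟨rfl, rfl⟩ | ⟨rfl, rfl⟩⟩ := hcherry v u w v a b hu hw huw ha hb hab
    · exact hinv φ u w
    · rw [hinv, hPsymm.apply]
  have hsum : ∑ a ∈ G.neighborFinset v, ∑ b ∈ G.neighborFinset v, P a b
      = lam ^ 2 * P v v := by
    have h : G.adjMatrix ℝ * (P * G.adjMatrix ℝ) = lam ^ 2 • P := by
      rw [hPA, Matrix.mul_smul, hAP, smul_smul, sq]
    have h' := congrFun (congrFun h v) v
    simpa [SimpleGraph.adjMatrix_mul_apply, SimpleGraph.mul_adjMatrix_apply] using h'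
  have hcard : (G.neighborFinset v).card = d := hreg v
  have hrow (a : V) (ha : a ∈ G.neighborFinset v) :
      ∑ b ∈ G.neighborFinset v, P a b = P v v + ((d : ℝ) - 1) * P u w := by
    rw [← Finset.add_sum_erase _ _ ha, hdiag, Finset.sum_congr rfl (g := fun _ => P u w)]
    · rw [Finset.sum_const, Finset.card_erase_of_mem ha, hcard, nsmul_eq_mul,
        Nat.cast_sub (by lia), Nat.cast_one]
    · intro b hb
      rw [Finset.mem_erase] at hb
      exact hoff a b (by simpa using ha) (by simpa using hb.2) hb.1.symm
  rw [Finset.sum_congr rfl hrow, Finset.sum_const, hcard, nsmul_eq_mul] at hsum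
  have hd' : (3 : ℝ) ≤ d := by exact_mod_cast hd
  have h0 : (d : ℝ) ≠ 0 := by linarith
  have h1 : (d : ℝ) - 1 ≠ 0 := by linarith
  field_simp
  linarith
end

section
/- Let G be a finite, d-regular (d ≥ 3), arc-transitive simple graph, let λ be an eigenvalue of its adjacency matrix A, and let P be the matrix of the orthogonal projection of ℝ^V onto the eigenspace {x : A x = λ x}. Then for every pair of adjacent vertices v and u, the entry P(v,u) equals (λ/d)·P(v,v). -/
open Matrix

namespace Matrix

variable {V R : Type*} [Fintype V] [CommRing R]

theorem mul_eq_smul_of_forall_mulVec {A P : Matrix V V R} {c : R}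
    (h : ∀ x : V → R, A *ᵥ (P *ᵥ x) = c • (P *ᵥ x)) : A * P = c • P := by
  classical
  apply Matrix.ext_of_mulVec_single
  intro i
  rw [← mulVec_mulVec, h, smul_mulVec]

theorem mul_eq_right_of_forall_mulVec_eq {A P Q : Matrix V V R} {c : R}
    (hfix : ∀ x : V → R, A *ᵥ x = c • x → P *ᵥ x = x) (hQ : A * Q = c • Q) :
    P * Q = Q := by
  classical
  apply Matrix.ext_of_mulVec_single
  intro i
  rw [← mulVec_mulVec]
  apply hfix
  rw [mulVec_mulVec, hQ, smul_mulVec]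

/-- A symmetric matrix projecting onto an eigenspace of `A` is invariant under every permutation
preserving `A`. -/
theorem submatrix_eq_self_of_eigenprojection {A P : Matrix V V R} {c : R} (hsymm : P.IsSymm)
    (hP : A * P = c • P) (hfix : ∀ x : V → R, A *ᵥ x = c • x → P *ᵥ x = x)
    (σ : Equiv.Perm V) (hσ : A.submatrix σ σ = A) : P.submatrix σ σ = P := by
  have key : ∀ τ : Equiv.Perm V, A.submatrix τ τ = A →
      P * P.submatrix τ τ = P.submatrix τ τ := by
    intro τ hτ
    apply mul_eq_right_of_forall_mulVec_eq hfix
    nth_rewrite 1 [← hτ]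
    rw [submatrix_mul_equiv, hP]
    rfl
  have hσ' : A.submatrix σ.symm σ.symm = A := by
    nth_rewrite 1 [← hσ]
    simp [submatrix_submatrix]
  have h : P.submatrix σ σ * P = P := by
    have := congrArg (fun M : Matrix V V R => M.submatrix σ σ) (key σ.symm hσ')
    simpa [← submatrix_mul_equiv (e₂ := σ), submatrix_submatrix] using this
  have h' := congrArg transpose h
  rw [transpose_mul, (hsymm.submatrix σ).eq, hsymm.eq, key σ hσ] at h'
  exact h'

end Matrix

/-- Let `G` be a finite, `d`-regular (`d ≥ 3`), arc-transitive simple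
graph, `lam` an eigenvalue of its adjacency matrix `A`, and `P` the matrix of the
orthogonal projection of `ℝ^V` onto the eigenspace `{x : A x = lam x}`. Then for every
pair of adjacent vertices `v, u` one has `P v u = (lam/d) · P v v`. -/
theorem arc_transitive_projection_entry
    {V : Type*} [Fintype V] [DecidableEq V] (G : SimpleGraph V) [DecidableRel G.Adj]
    (d : ℕ) (hd : 3 ≤ d) (hreg : G.IsRegularOfDegree d)
    (harc : ∀ u₁ v₁ u₂ v₂ : V, G.Adj u₁ v₁ → G.Adj u₂ v₂ →
      ∃ φ : G ≃g G, φ u₁ = u₂ ∧ φ v₁ = v₂)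
    (lam : ℝ) (hlam : ∃ x : V → ℝ, x ≠ 0 ∧ G.adjMatrix ℝ *ᵥ x = lam • x)
    (P : Matrix V V ℝ)
    (hPsymm : P.IsSymm) (hPidem : P * P = P)
    (hPrange : ∀ x : V → ℝ, G.adjMatrix ℝ *ᵥ (P *ᵥ x) = lam • (P *ᵥ x))
    (hPfix : ∀ x : V → ℝ, G.adjMatrix ℝ *ᵥ x = lam • x → P *ᵥ x = x) :
    ∀ v u : V, G.Adj v u → P v u = (lam / d) * P v v := by
  intro v u huv
  have hAP := mul_eq_smul_of_forall_mulVec hPrange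
  have hnbr : ∀ w ∈ G.neighborFinset v, P w v = P v u := by
    intro w hw
    obtain ⟨φ, hv, hu⟩ := harc v u v w huv ((G.mem_neighborFinset v w).1 hw)
    have hA : (G.adjMatrix ℝ).submatrix φ.toEquiv φ.toEquiv = G.adjMatrix ℝ := by
      ext a b
      simp [SimpleGraph.adjMatrix_apply, φ.map_adj_iff]
    have h := congrFun₂ (submatrix_eq_self_of_eigenprojection hPsymm hAP hPfix φ.toEquiv hA) v u
    simp only [submatrix_apply, RelIso.coe_fn_toEquiv, hv, hu] at h
    rw [hPsymm.apply, h]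
  have h := congrFun₂ hAP v v
  rw [SimpleGraph.adjMatrix_mul_apply, Finset.sum_congr rfl hnbr, Finset.sum_const,
    SimpleGraph.card_neighborFinset_eq_degree, hreg.degree_eq v, nsmul_eq_mul, Matrix.smul_apply,
    smul_eq_mul] at h
  have hd' : (d : ℝ) ≠ 0 := by positivity
  field_simp
  linarith
end
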